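/- arXiv:2605.12707 — 6 statements merged into one kernel-verified Lean document; each statement's English description precedes it below -/
import Mathlib

section
/- Let 1 < α < 2 and let f : [0,1] → ℝ be continuous. Define G(x,z) = (1/Γ(α))·[(x(1−z))^{α−1} − (x−z)^{α−1}] for 0 ≤ z ≤ x ≤ 1 and G(x,z) = (1/Γ(α))·x^{α−1}(1−z)^{α−1} for 0 ≤ x ≤ z ≤ 1, and set u(x) = ∫₀¹ G(x,z) f(z) dz. Then u(0) = u(1) = 0 and, for every x ∈ (0,1), the left Riemann–Liouville derivative of u of order α exists and satisfies −(₀D_x^α u)(x) = f(x). -/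
open MeasureTheory Set intervalIntegral

/-- The left Riemann–Liouville Green's kernel on `[0,1]` for order `α`. -/
noncomputable def rlGreen (α : ℝ) (x z : ℝ) : ℝ :=
  if z ≤ x then (1 / Real.Gamma α) * ((x * (1 - z)) ^ (α - 1) - (x - z) ^ (α - 1))
  else (1 / Real.Gamma α) * (x ^ (α - 1) * (1 - z) ^ (α - 1))

/-- The fractional integral `x ↦ (1/Γ(2-α)) ∫₀ˣ (x-t)^{1-α} u(t) dt`; the left
Riemann–Liouville derivative of order `α ∈ (1,2)` of `u` is its second derivative. -/
noncomputable def fracIntL (α : ℝ) (u : ℝ → ℝ) : ℝ → ℝ :=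
  fun x => (1 / Real.Gamma (2 - α)) * ∫ t in (0:ℝ)..x, (x - t) ^ (1 - α) * u t

/-- Fubini's theorem for an integrable function times a jointly continuous kernel. -/
theorem integral_mul_integral_swap {a b c d : ℝ} (hab : a ≤ b) (hcd : c ≤ d) {φ : ℝ → ℝ}
    (hφ : IntervalIntegrable φ volume a b) {Q : ℝ → ℝ → ℝ}
    (hQ : Continuous (Function.uncurry Q)) :
    ∫ t in a..b, φ t * ∫ z in c..d, Q t z = ∫ z in c..d, ∫ t in a..b, φ t * Q t z := by
  simp_rw [← intervalIntegral.integral_const_mul]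
  simp only [intervalIntegral.integral_of_le hab, intervalIntegral.integral_of_le hcd]
  refine MeasureTheory.integral_integral_swap (f := fun t z => φ t * Q t z) ?_
  rw [intervalIntegrable_iff_integrableOn_Ioc_of_le hab] at hφ
  have hφ' : Integrable (fun p : ℝ × ℝ => φ p.1)
      ((volume.restrict (Ioc a b)).prod (volume.restrict (Ioc c d))) :=
    Integrable.comp_fst hφ _
  obtain ⟨C, hC⟩ := (isCompact_Icc.prod isCompact_Icc).exists_bound_of_continuousOn
    (hQ.continuousOn (s := Icc a b ×ˢ Icc c d))
  refine hφ'.mul_bdd (c := C) hQ.aestronglyMeasurable ?_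
  rw [Measure.prod_restrict]
  filter_upwards [ae_restrict_mem (measurableSet_Ioc.prod measurableSet_Ioc)] with p hp
  exact hC p ⟨Ioc_subset_Icc_self hp.1, Ioc_subset_Icc_self hp.2⟩

/-- The Euler beta integral over `[0, a]`, for exponents summing to zero. -/
theorem integral_rpow_mul_sub_rpow {α a : ℝ} (hα₁ : 1 < α) (hα₂ : α < 2) (ha : 0 < a) :
    ∫ t in (0:ℝ)..a, (a - t) ^ (1 - α) * t ^ (α - 1)
      = Real.Gamma (2 - α) * Real.Gamma α * a := by
  have h := Complex.betaIntegral_scaled (α : ℂ) ((2 - α : ℝ) : ℂ) ha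
  rw [Complex.betaIntegral_eq_Gamma_mul_div _ _ (by simp; linarith) (by simp; linarith)] at h
  have e : (α : ℂ) + ((2 - α : ℝ) : ℂ) = 2 := by push_cast; ring
  rw [e, Complex.Gamma_ofReal, Complex.Gamma_ofReal, Complex.Gamma_ofNat_eq_factorial] at h
  have h2 : ∫ t in (0:ℝ)..a, (t : ℂ) ^ ((α : ℂ) - 1) * ((a : ℂ) - t) ^ (((2 - α : ℝ) : ℂ) - 1)
      = ∫ t in (0:ℝ)..a, (((a - t) ^ (1 - α) * t ^ (α - 1) : ℝ) : ℂ) := by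
    refine intervalIntegral.integral_congr fun t ht => ?_
    rw [uIcc_of_le ha.le] at ht
    rw [Complex.ofReal_mul, Complex.ofReal_cpow (sub_nonneg.2 ht.2), Complex.ofReal_cpow ht.1,
      mul_comm]
    push_cast
    congr 2
    ring
  rw [h2, intervalIntegral.integral_ofReal] at h
  apply Complex.ofReal_injective
  rw [h]
  norm_num
  ring

theorem intervalIntegrable_sub_rpow {r : ℝ} (hr : -1 < r) (x : ℝ) :
    IntervalIntegrable (fun t => (x - t) ^ r) volume 0 x := by
  simpa using (intervalIntegral.intervalIntegrable_rpow' (a := x) (b := 0) hr).comp_sub_left x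

theorem integral_sub_rpow_mul_posPart_rpow {α x z : ℝ} (hα₁ : 1 < α) (hα₂ : α < 2)
    (hx : 0 ≤ x) (hz : 0 ≤ z) :
    ∫ t in (0:ℝ)..x, (x - t) ^ (1 - α) * (max (t - z) 0) ^ (α - 1)
      = Real.Gamma (2 - α) * Real.Gamma α * max (x - z) 0 := by
  have hne : α - 1 ≠ 0 := by linarith
  rcases le_or_gt x z with hxz | hxz
  · rw [max_eq_right (by linarith), mul_zero]
    refine intervalIntegral.integral_zero_ae (Filter.Eventually.of_forall fun t ht => ?_)
    rw [uIoc_of_le hx] at ht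
    rw [max_eq_right (by linarith [ht.2]), Real.zero_rpow hne, mul_zero]
  · have hint := intervalIntegrable_sub_rpow (r := 1 - α) (by linarith) x
    have hcont : Continuous fun t : ℝ => (max (t - z) 0) ^ (α - 1) :=
      Continuous.rpow_const (by fun_prop) fun _ => Or.inr (by linarith)
    have hI : IntervalIntegrable (fun t => (x - t) ^ (1 - α) * (max (t - z) 0) ^ (α - 1))
        volume 0 x := hint.mul_continuousOn hcont.continuousOn
    have hz' : z ∈ uIcc 0 x := by rw [uIcc_of_le hx]; exact ⟨hz, hxz.le⟩
    rw [← intervalIntegral.integral_add_adjacent_intervals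
      (hI.mono_set (uIcc_subset_uIcc_left hz')) (hI.mono_set (uIcc_subset_uIcc_right hz'))]
    have h1 : ∫ t in (0:ℝ)..z, (x - t) ^ (1 - α) * (max (t - z) 0) ^ (α - 1) = 0 := by
      refine intervalIntegral.integral_zero_ae (Filter.Eventually.of_forall fun t ht => ?_)
      rw [uIoc_of_le hz] at ht
      rw [max_eq_right (by linarith [ht.2]), Real.zero_rpow hne, mul_zero]
    have h2 : ∫ t in z..x, (x - t) ^ (1 - α) * (max (t - z) 0) ^ (α - 1)
        = ∫ t in z..x, (x - z - (t - z)) ^ (1 - α) * (t - z) ^ (α - 1) := by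
      refine intervalIntegral.integral_congr fun t ht => ?_
      rw [uIcc_of_le hxz.le] at ht
      rw [max_eq_left (by linarith [ht.1]), sub_sub_sub_cancel_right]
    rw [h1, h2, zero_add, intervalIntegral.integral_comp_sub_right
      (fun s => (x - z - s) ^ (1 - α) * s ^ (α - 1)), sub_self,
      integral_rpow_mul_sub_rpow hα₁ hα₂ (sub_pos.2 hxz), max_eq_left (by linarith)]

theorem rlGreen_eq_posPart {α t z : ℝ} (hα : 1 < α) (ht : 0 ≤ t) (hz : z ≤ 1) :
    rlGreen α t z = (1 / Real.Gamma α) *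
      ((max (t - 0) 0) ^ (α - 1) * (1 - z) ^ (α - 1) - (max (t - z) 0) ^ (α - 1)) := by
  rw [sub_zero, max_eq_left ht]
  unfold rlGreen
  split_ifs with h
  · rw [Real.mul_rpow ht (by linarith), max_eq_left (by linarith)]
  · rw [max_eq_right (by linarith), Real.zero_rpow (by linarith), sub_zero]

/-- The fractional integral of the Green's potential of a continuous function. -/
theorem fracIntL_integral_rlGreen {α x : ℝ} (hα₁ : 1 < α) (hα₂ : α < 2) (hx₀ : 0 ≤ x) (hx₁ : x ≤ 1)
    {g : ℝ → ℝ} (hg : Continuous g) :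
    fracIntL α (fun t => ∫ z in (0:ℝ)..1, rlGreen α t z * g z) x
      = x * (∫ z in (0:ℝ)..1, (1 - z) ^ (α - 1) * g z)
        - (x * (∫ z in (0:ℝ)..x, g z) - ∫ z in (0:ℝ)..x, z * g z) := by
  have hpos : ∀ z : ℝ, Continuous fun t : ℝ => (max (t - z) 0) ^ (α - 1) := fun z =>
    Continuous.rpow_const (by fun_prop) fun _ => Or.inr (by linarith)
  have hint := intervalIntegrable_sub_rpow (r := 1 - α) (by linarith) x
  have hc1 : Continuous fun z : ℝ => (1 - z) ^ (α - 1) :=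
    Continuous.rpow_const (by fun_prop) fun _ => Or.inr (by linarith)
  have hQ : Continuous (Function.uncurry fun t z : ℝ => (1 / Real.Gamma α) *
      ((max (t - 0) 0) ^ (α - 1) * (1 - z) ^ (α - 1) - (max (t - z) 0) ^ (α - 1)) * g z) := by
    have h1 : Continuous fun p : ℝ × ℝ => (max (p.1 - p.2) 0) ^ (α - 1) :=
      Continuous.rpow_const (by fun_prop) fun _ => Or.inr (by linarith)
    exact (continuous_const.mul ((((hpos 0).comp continuous_fst).mul
      (hc1.comp continuous_snd)).sub h1)).mul (hg.comp continuous_snd)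
  have e1 : ∫ t in (0:ℝ)..x, (x - t) ^ (1 - α) * ∫ z in (0:ℝ)..1, rlGreen α t z * g z
      = ∫ t in (0:ℝ)..x, (x - t) ^ (1 - α) * ∫ z in (0:ℝ)..1, (1 / Real.Gamma α) *
      ((max (t - 0) 0) ^ (α - 1) * (1 - z) ^ (α - 1) - (max (t - z) 0) ^ (α - 1)) * g z := by
    refine intervalIntegral.integral_congr fun t ht => ?_
    rw [uIcc_of_le hx₀] at ht
    congr 1
    refine intervalIntegral.integral_congr fun z hz => ?_
    rw [uIcc_of_le zero_le_one] at hz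
    rw [rlGreen_eq_posPart hα₁ ht.1 hz.2]
  have hΓ1 : Real.Gamma α ≠ 0 := (Real.Gamma_pos_of_pos (by linarith)).ne'
  have hΓ2 : Real.Gamma (2 - α) ≠ 0 := (Real.Gamma_pos_of_pos (by linarith)).ne'
  have e2 : ∀ z ∈ uIcc (0:ℝ) 1, ∫ t in (0:ℝ)..x, (x - t) ^ (1 - α) * ((1 / Real.Gamma α) *
      ((max (t - 0) 0) ^ (α - 1) * (1 - z) ^ (α - 1) - (max (t - z) 0) ^ (α - 1)) * g z)
      = Real.Gamma (2 - α) * (x * ((1 - z) ^ (α - 1) * g z) - max (x - z) 0 * g z) := by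
    intro z hz
    rw [uIcc_of_le zero_le_one] at hz
    have hI : ∀ z : ℝ, IntervalIntegrable
        (fun t => (x - t) ^ (1 - α) * (max (t - z) 0) ^ (α - 1)) volume 0 x := fun z =>
      hint.mul_continuousOn (hpos z).continuousOn
    have e3 : ∀ t : ℝ, (x - t) ^ (1 - α) * ((1 / Real.Gamma α) *
        ((max (t - 0) 0) ^ (α - 1) * (1 - z) ^ (α - 1) - (max (t - z) 0) ^ (α - 1)) * g z)
        = (1 / Real.Gamma α * (1 - z) ^ (α - 1) * g z) *
            ((x - t) ^ (1 - α) * (max (t - 0) 0) ^ (α - 1))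
          - (1 / Real.Gamma α * g z) * ((x - t) ^ (1 - α) * (max (t - z) 0) ^ (α - 1)) :=
      fun t => by ring
    simp_rw [e3]
    rw [intervalIntegral.integral_sub ((hI 0).const_mul _) ((hI z).const_mul _),
      intervalIntegral.integral_const_mul, intervalIntegral.integral_const_mul,
      integral_sub_rpow_mul_posPart_rpow hα₁ hα₂ hx₀ le_rfl,
      integral_sub_rpow_mul_posPart_rpow hα₁ hα₂ hx₀ hz.1, sub_zero, max_eq_left hx₀]
    field_simp
  have hm : Continuous fun z : ℝ => max (x - z) 0 * g z := by fun_prop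
  have e4 : ∫ z in (0:ℝ)..1, max (x - z) 0 * g z
      = x * (∫ z in (0:ℝ)..x, g z) - ∫ z in (0:ℝ)..x, z * g z := by
    rw [← intervalIntegral.integral_add_adjacent_intervals
      (hm.intervalIntegrable 0 x) (hm.intervalIntegrable x 1)]
    have h1 : ∫ z in x..1, max (x - z) 0 * g z = 0 := by
      refine intervalIntegral.integral_zero_ae (Filter.Eventually.of_forall fun z hz => ?_)
      rw [uIoc_of_le hx₁] at hz
      rw [max_eq_right (by linarith [hz.1]), zero_mul]
    have h2 : ∫ z in (0:ℝ)..x, max (x - z) 0 * g z = ∫ z in (0:ℝ)..x, (x * g z - z * g z) := by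
      refine intervalIntegral.integral_congr fun z hz => ?_
      rw [uIcc_of_le hx₀] at hz
      rw [max_eq_left (by linarith [hz.2]), sub_mul]
    have hi1 : Continuous fun z => x * g z := by fun_prop
    have hi2 : Continuous fun z => z * g z := by fun_prop
    rw [h1, h2, add_zero, intervalIntegral.integral_sub
      (hi1.intervalIntegrable _ _) (hi2.intervalIntegrable _ _), intervalIntegral.integral_const_mul]
  have hc2 : Continuous fun z => x * ((1 - z) ^ (α - 1) * g z) := continuous_const.mul (hc1.mul hg)
  unfold fracIntL
  rw [e1, integral_mul_integral_swap hx₀ zero_le_one hint hQ,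
    intervalIntegral.integral_congr e2, intervalIntegral.integral_const_mul,
    intervalIntegral.integral_sub
      (hc2.intervalIntegrable _ _) (hm.intervalIntegrable _ _),
    intervalIntegral.integral_const_mul, e4]
  field_simp

theorem stmt_0 (α : ℝ) (hα₁ : 1 < α) (hα₂ : α < 2)
    (f : ℝ → ℝ) (hf : ContinuousOn f (Set.Icc 0 1))
    (u : ℝ → ℝ) (hu : ∀ x, u x = ∫ z in (0:ℝ)..1, rlGreen α x z * f z) :
    u 0 = 0 ∧ u 1 = 0 ∧
      ∀ x ∈ Set.Ioo (0:ℝ) 1,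
        DifferentiableAt ℝ (fracIntL α u) x ∧
        DifferentiableAt ℝ (deriv (fracIntL α u)) x ∧
        deriv (deriv (fracIntL α u)) x = - f x := by
  have hne : α - 1 ≠ 0 := by linarith
  refine ⟨?_, ?_, ?_⟩
  · rw [hu]
    refine intervalIntegral.integral_zero_ae (Filter.Eventually.of_forall fun z hz => ?_)
    rw [uIoc_of_le zero_le_one] at hz
    rw [rlGreen_eq_posPart hα₁ le_rfl hz.2, max_eq_right (by linarith),
      max_eq_right (by linarith [hz.1]), Real.zero_rpow hne]
    ring
  · rw [hu]
    refine intervalIntegral.integral_zero_ae (Filter.Eventually.of_forall fun z hz => ?_)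
    rw [uIoc_of_le zero_le_one] at hz
    rw [rlGreen, if_pos hz.2, one_mul, sub_self, mul_zero, zero_mul]
  · let g : ℝ → ℝ := IccExtend (zero_le_one' ℝ) ((Icc (0:ℝ) 1).domRestrict f)
    have hg : Continuous g := (continuousOn_iff_continuous_domRestrict.1 hf).Icc_extend'
    have hgf : ∀ z ∈ Icc (0:ℝ) 1, g z = f z := fun z hz => IccExtend_of_mem _ _ hz
    have hu' : u = fun t => ∫ z in (0:ℝ)..1, rlGreen α t z * g z := by
      funext t
      rw [hu]
      refine intervalIntegral.integral_congr fun z hz => ?_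
      rw [uIcc_of_le zero_le_one] at hz
      rw [hgf z hz]
    set C := ∫ z in (0:ℝ)..1, (1 - z) ^ (α - 1) * g z with hC
    have hG : ∀ x : ℝ, HasDerivAt (fun y => ∫ z in (0:ℝ)..y, g z) (g x) x := fun x =>
      (hg.integral_hasStrictDerivAt 0 x).hasDerivAt
    have hF : ∀ x ∈ Ioo (0:ℝ) 1,
        HasDerivAt (fracIntL α u) (C - ∫ z in (0:ℝ)..x, g z) x := by
      intro x hx
      have h1 : HasDerivAt (fun y => ∫ z in (0:ℝ)..y, z * g z) (x * g x) x :=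
        ((continuous_id.mul hg).integral_hasStrictDerivAt 0 x).hasDerivAt
      have h2 := ((hasDerivAt_id x).mul_const C).sub
        (((hasDerivAt_id x).mul (hG x)).sub h1)
      refine (h2.congr_of_eventuallyEq ?_).congr_deriv (by simp)
      filter_upwards [isOpen_Ioo.mem_nhds hx] with y hy
      rw [hu', fracIntL_integral_rlGreen hα₁ hα₂ hy.1.le hy.2.le hg]
      rfl
    intro x hx
    have h2 : HasDerivAt (deriv (fracIntL α u)) (- f x) x := by
      rw [← hgf x (Ioo_subset_Icc_self hx)]
      refine ((hG x).const_sub C).congr_of_eventuallyEq ?_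
      filter_upwards [isOpen_Ioo.mem_nhds hx] with y hy
      exact (hF y hy).deriv
    exact ⟨(hF x hx).differentiableAt, h2.differentiableAt, h2.deriv⟩
end

section
/- Let 1 < α < 2 and let f : [0,1] → ℝ be continuous. Suppose u ∈ C¹([0,1]) is such that u′ is absolutely continuous with u″ ∈ L¹(0,1), that u(0) = u(1) = 0, and that −(₀^C D_x^α u)(x) = f(x) for every x ∈ (0,1). Then u(x) = ∫₀¹ G_C(x,z) f(z) dz for every x ∈ [0,1], where G_C(x,z) = (1/Γ(α))·[x(1−z)^{α−1} − (x−z)^{α−1}] for 0 ≤ z ≤ x ≤ 1 and G_C(x,z) = (1/Γ(α))·x(1−z)^{α−1} for 0 ≤ x ≤ z ≤ 1. -/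
open MeasureTheory Set intervalIntegral

/-- The Caputo Green's kernel on `[0,1]` for order `α`. -/
noncomputable def caputoGreen (α : ℝ) (x z : ℝ) : ℝ :=
  if z ≤ x then (1 / Real.Gamma α) * (x * (1 - z) ^ (α - 1) - (x - z) ^ (α - 1))
  else (1 / Real.Gamma α) * (x * (1 - z) ^ (α - 1))

/-- The shifted Euler beta integral. -/
theorem integral_sub_rpow_mul_sub_rpow {a b t x : ℝ} (ha : 0 < a) (hb : 0 < b) (htx : t < x) :
    ∫ s in t..x, (x - s) ^ (a - 1) * (s - t) ^ (b - 1) =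
      ProbabilityTheory.beta a b * (x - t) ^ (a + b - 1) := by
  have hc : 0 < x - t := sub_pos.mpr htx
  have shift : ∫ s in t..x, (x - s) ^ (a - 1) * (s - t) ^ (b - 1) =
      ∫ r in (0 : ℝ)..(x - t), r ^ (b - 1) * (x - t - r) ^ (a - 1) := by
    rw [← sub_self t, ← intervalIntegral.integral_comp_sub_right
      (fun r => r ^ (b - 1) * (x - t - r) ^ (a - 1)) t]
    refine intervalIntegral.integral_congr fun s _ => ?_
    simp only [sub_sub_sub_cancel_right]
    exact mul_comm _ _
  have scaled := Complex.betaIntegral_scaled (b : ℂ) (a : ℂ) hc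
  have cast : ∫ r in (0 : ℝ)..(x - t), (r : ℂ) ^ ((b : ℂ) - 1) *
      (((x - t : ℝ) : ℂ) - r) ^ ((a : ℂ) - 1) =
      ((∫ r in (0 : ℝ)..(x - t), r ^ (b - 1) * (x - t - r) ^ (a - 1) : ℝ) : ℂ) := by
    rw [← intervalIntegral.integral_ofReal]
    refine intervalIntegral.integral_congr fun r hr => ?_
    rw [uIcc_of_le hc.le] at hr
    rw [Complex.ofReal_mul, Complex.ofReal_cpow hr.1, Complex.ofReal_cpow (sub_nonneg.mpr hr.2)]
    push_cast
    rfl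
  have hpow : ((x - t : ℝ) : ℂ) ^ ((b : ℂ) + a - 1) = (((x - t) ^ (a + b - 1) : ℝ) : ℂ) := by
    rw [Complex.ofReal_cpow hc.le]
    push_cast
    rw [add_comm]
  rw [cast, hpow, Complex.betaIntegral_symm] at scaled
  rw [shift, ProbabilityTheory.beta_eq_betaIntegralReal a b ha hb, mul_comm,
    ← Complex.re_ofReal_mul, ← scaled, Complex.ofReal_re]

theorem intervalIntegrable_sub_rpow_mul_sub_rpow {a b t x : ℝ} (ha : 0 < a) (hb : 0 < b)
    (htx : t < x) :
    IntervalIntegrable (fun s => (x - s) ^ (a - 1) * (s - t) ^ (b - 1)) volume t x := by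
  apply intervalIntegrable_of_integral_ne_zero
  rw [integral_sub_rpow_mul_sub_rpow ha hb htx]
  exact (mul_pos (ProbabilityTheory.beta_pos ha hb)
    (Real.rpow_pos_of_pos (sub_pos.mpr htx) _)).ne'

/-- The semigroup law of the Riemann–Liouville integral, with the Gamma factors collected in a beta
constant. -/
theorem integral_sub_rpow_mul_integral_sub_rpow_mul {a b x : ℝ} (ha : 0 < a) (hb : 0 < b)
    (hab : 1 ≤ a + b) (hx : 0 ≤ x) {g : ℝ → ℝ} (hg : IntervalIntegrable g volume 0 x) :
    ∫ s in (0 : ℝ)..x, (x - s) ^ (a - 1) * ∫ t in (0 : ℝ)..s, (s - t) ^ (b - 1) * g t =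
      ProbabilityTheory.beta a b * ∫ t in (0 : ℝ)..x, (x - t) ^ (a + b - 1) * g t := by
  let k : ℝ → ℝ → ℝ := fun s t => (x - s) ^ (a - 1) * (s - t) ^ (b - 1)
  let K : ℝ → ℝ → ℝ := fun s t => (Ioi t).indicator (fun s => k s t * g t) s
  let μ : Measure ℝ := volume.restrict (Ioc 0 x)
  have hgμ : Integrable g μ := (intervalIntegrable_iff_integrableOn_Ioc_of_le hx).1 hg
  have slice : ∀ t ∈ Ioo 0 x, ∀ c : ℝ,
      ∫ s in Ioc 0 x, (Ioi t).indicator (fun s => k s t * c) s =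
        ProbabilityTheory.beta a b * ((x - t) ^ (a + b - 1) * c) := by
    intro t ht c
    have hset : Ioc 0 x ∩ Ioi t = Ioc t x := by
      ext s; simp only [mem_inter_iff, mem_Ioc, mem_Ioi]
      exact ⟨fun h => ⟨h.2, h.1.2⟩, fun h => ⟨⟨ht.1.trans h.1, h.2⟩, h.1⟩⟩
    rw [setIntegral_indicator measurableSet_Ioi, hset, MeasureTheory.integral_mul_const,
      ← intervalIntegral.integral_of_le ht.2.le, integral_sub_rpow_mul_sub_rpow ha hb ht.2, mul_assoc]
  have hmem : ∀ᵐ t ∂μ, t ∈ Ioo 0 x := by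
    have : ∀ᵐ t ∂μ, t ≠ x := ae_restrict_of_ae (Measure.ae_ne volume x)
    filter_upwards [this, ae_restrict_mem measurableSet_Ioc] with t h1 h2
    exact ⟨h2.1, lt_of_le_of_ne h2.2 h1⟩
  have hmeas : AEStronglyMeasurable (Function.uncurry K) (μ.prod μ) := by
    have hS : MeasurableSet {p : ℝ × ℝ | p.2 < p.1} := measurableSet_lt measurable_snd measurable_fst
    have hk : Measurable fun p : ℝ × ℝ => k p.1 p.2 := by fun_prop
    exact (hk.aestronglyMeasurable.mul hgμ.aestronglyMeasurable.comp_snd).indicator hS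
  have hKint : Integrable (Function.uncurry K) (μ.prod μ) := by
    rw [integrable_prod_iff' hmeas]
    constructor
    · filter_upwards [hmem] with t ht
      refine IntegrableOn.integrable_indicator ?_ measurableSet_Ioi |>.congr (.refl _ _)
      have hint := (intervalIntegrable_iff_integrableOn_Ioc_of_le ht.2.le).1
        (intervalIntegrable_sub_rpow_mul_sub_rpow ha hb ht.2)
      have : IntegrableOn (fun s => k s t * g t) (Ioc t x) := hint.mul_const (g t)
      rw [IntegrableOn, Measure.restrict_restrict measurableSet_Ioi]
      exact this.mono_set fun s hs => ⟨hs.1, hs.2.2⟩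
    · have hcont : ContinuousOn (fun t : ℝ => (x - t) ^ (a + b - 1)) (uIcc 0 x) :=
        ((continuous_const.sub continuous_id).rpow_const
          fun _ => Or.inr (by linarith)).continuousOn
      have hbound : Integrable
          (fun t => ProbabilityTheory.beta a b * ((x - t) ^ (a + b - 1) * ‖g t‖)) μ :=
        ((intervalIntegrable_iff_integrableOn_Ioc_of_le hx).1
          (hg.norm.continuousOn_mul hcont)).const_mul _
      refine hbound.congr ?_
      filter_upwards [hmem] with t ht
      rw [← slice t ht]
      refine setIntegral_congr_fun measurableSet_Ioc fun s hs => ?_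
      simp only [Function.uncurry_apply_pair, K, indicator_apply, mem_Ioi]
      split_ifs with h
      · have : 0 ≤ k s t := mul_nonneg (Real.rpow_nonneg (sub_nonneg.mpr hs.2) _)
          (Real.rpow_nonneg (sub_nonneg.mpr (le_of_lt h)) _)
        rw [norm_mul, Real.norm_of_nonneg this]
      · simp
  have inner : ∀ s ∈ Ioc 0 x, ∫ t, K s t ∂μ =
      (x - s) ^ (a - 1) * ∫ t in (0 : ℝ)..s, (s - t) ^ (b - 1) * g t := by
    intro s hs
    have hset : Ioc 0 x ∩ Iio s = Ioo 0 s := by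
      ext t; simp only [mem_inter_iff, mem_Ioc, mem_Iio, mem_Ioo]
      exact ⟨fun h => ⟨h.1.1, h.2⟩, fun h => ⟨⟨h.1, h.2.le.trans hs.2⟩, h.2⟩⟩
    have hK : K s = (Iio s).indicator fun t => (x - s) ^ (a - 1) * ((s - t) ^ (b - 1) * g t) := by
      ext t; simp only [K, k, indicator_apply, mem_Ioi, mem_Iio, mul_assoc]
    rw [hK, setIntegral_indicator measurableSet_Iio, hset, MeasureTheory.integral_const_mul,
      intervalIntegral.integral_of_le hs.1.le, integral_Ioc_eq_integral_Ioo]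
  rw [intervalIntegral.integral_of_le hx, ← setIntegral_congr_fun measurableSet_Ioc inner,
    integral_integral_swap hKint, intervalIntegral.integral_of_le hx, ← MeasureTheory.integral_const_mul]
  refine integral_congr_ae ?_
  filter_upwards [hmem] with t ht using slice t ht (g t)

theorem integral_caputoGreen_mul {α : ℝ} (hα : 1 ≤ α) {f : ℝ → ℝ} (hf : ContinuousOn f (Icc 0 1))
    {x : ℝ} (hx : x ∈ Icc (0 : ℝ) 1) :
    ∫ z in (0 : ℝ)..1, caputoGreen α x z * f z =
      1 / Real.Gamma α * (x * (∫ z in (0 : ℝ)..1, (1 - z) ^ (α - 1) * f z) -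
        ∫ z in (0 : ℝ)..x, (x - z) ^ (α - 1) * f z) := by
  have hint : ∀ y : ℝ, IntervalIntegrable (fun z => (y - z) ^ (α - 1) * f z) volume 0 1 := by
    intro y
    apply ContinuousOn.intervalIntegrable
    rw [uIcc_of_le zero_le_one]
    exact ((continuous_const.sub continuous_id).rpow_const
      fun _ => Or.inr (by linarith)).continuousOn.mul hf
  have hind : IntervalIntegrable
      (indicator {z | z ≤ x} fun z => (x - z) ^ (α - 1) * f z) volume 0 1 := by
    have := (intervalIntegrable_iff_integrableOn_Ioc_of_le zero_le_one).1 (hint x)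
    rw [intervalIntegrable_iff_integrableOn_Ioc_of_le zero_le_one]
    exact this.indicator measurableSet_Iic
  have hsplit : ∀ z, caputoGreen α x z * f z = 1 / Real.Gamma α *
      (x * ((1 - z) ^ (α - 1) * f z) -
        indicator {z | z ≤ x} (fun z => (x - z) ^ (α - 1) * f z) z) := by
    intro z
    simp only [caputoGreen, indicator_apply, mem_ofPred_eq]
    split_ifs <;> ring
  simp_rw [hsplit]
  rw [intervalIntegral.integral_const_mul,
    intervalIntegral.integral_sub ((hint 1).const_mul x) hind,
    intervalIntegral.integral_const_mul, intervalIntegral.integral_indicator hx]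

theorem stmt_3 (α : ℝ) (hα₁ : 1 < α) (hα₂ : α < 2)
    (f : ℝ → ℝ) (hf : ContinuousOn f (Set.Icc 0 1))
    -- `u ∈ C¹([0,1])` with derivative `u'` ...
    (u u' : ℝ → ℝ)
    (hu' : ∀ x ∈ Set.Icc (0:ℝ) 1, HasDerivWithinAt u (u' x) (Set.Icc 0 1) x)
    (hu'c : ContinuousOn u' (Set.Icc 0 1))
    -- ... `u'` absolutely continuous with density `u'' = g ∈ L¹(0,1)` ...
    (g : ℝ → ℝ) (hg : IntervalIntegrable g volume 0 1)
    (hac : ∀ x ∈ Set.Icc (0:ℝ) 1, u' x = u' 0 + ∫ t in (0:ℝ)..x, g t)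
    -- boundary conditions:
    (hu0 : u 0 = 0) (hu1 : u 1 = 0)
    -- `-(₀^C D_x^α u)(x) = f(x)` for every `x ∈ (0,1)`:
    (hode : ∀ x ∈ Set.Ioo (0:ℝ) 1,
      - ((1 / Real.Gamma (2 - α)) * ∫ t in (0:ℝ)..x, (x - t) ^ (1 - α) * g t)
        = f x) :
    ∀ x ∈ Set.Icc (0:ℝ) 1, u x = ∫ z in (0:ℝ)..1, caputoGreen α x z * f z := by
  have hsub : ∀ {x : ℝ}, x ∈ Icc (0 : ℝ) 1 → IntervalIntegrable g volume 0 x := fun {x} hx =>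
    hg.mono_set (by rw [uIcc_of_le hx.1, uIcc_of_le zero_le_one]; exact Icc_subset_Icc_right hx.2)
  have taylor : ∀ x ∈ Icc (0 : ℝ) 1, u x = u' 0 * x + ∫ t in (0 : ℝ)..x, (x - t) * g t := by
    intro x hx
    have hsubset : Icc 0 x ⊆ Icc (0 : ℝ) 1 := Icc_subset_Icc_right hx.2
    have ftc : ∫ s in (0 : ℝ)..x, u' s = u x - u 0 := by
      refine integral_eq_sub_of_hasDerivAt_of_le hx.1
        (fun s hs => ((hu' s (hsubset hs)).continuousWithinAt).mono hsubset)
        (fun s hs => (hu' s (hsubset (Ioo_subset_Icc_self hs))).hasDerivAt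
          (Icc_mem_nhds hs.1 (hs.2.trans_le hx.2))) ?_
      apply ContinuousOn.intervalIntegrable
      rw [uIcc_of_le hx.1]
      exact hu'c.mono hsubset
    have hdouble := integral_sub_rpow_mul_integral_sub_rpow_mul one_pos one_pos
      (by norm_num) hx.1 (hsub hx)
    norm_num [ProbabilityTheory.beta] at hdouble
    have hu'int : ∫ s in (0 : ℝ)..x, u' s - u' 0 = ∫ s in (0 : ℝ)..x, ∫ t in (0 : ℝ)..s, g t := by
      refine intervalIntegral.integral_congr fun s hs => ?_
      rw [uIcc_of_le hx.1] at hs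
      simp only [hac s (hsubset hs), add_sub_cancel_left]
    rw [intervalIntegral.integral_sub _ intervalIntegrable_const, ftc, hu0, hdouble,
      intervalIntegral.integral_const, smul_eq_mul] at hu'int
    · linarith
    · apply ContinuousOn.intervalIntegrable
      rw [uIcc_of_le hx.1]
      exact hu'c.mono hsubset
  have hΓ : 0 < Real.Gamma α := Real.Gamma_pos_of_pos (by linarith)
  have hΓ' : 0 < Real.Gamma (2 - α) := Real.Gamma_pos_of_pos (by linarith)
  have potential : ∀ x ∈ Icc (0 : ℝ) 1, ∫ z in (0 : ℝ)..x, (x - z) ^ (α - 1) * f z =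
      -(Real.Gamma α * ∫ t in (0 : ℝ)..x, (x - t) * g t) := by
    intro x hx
    have hsemi := integral_sub_rpow_mul_integral_sub_rpow_mul (a := α) (b := 2 - α)
      (by linarith) (by linarith) (by linarith) hx.1 (hsub hx)
    rw [show α + (2 - α) - 1 = 1 by ring, show 2 - α - 1 = 1 - α by ring] at hsemi
    simp only [Real.rpow_one, ProbabilityTheory.beta, add_sub_cancel, Real.Gamma_two,
      div_one] at hsemi
    have hcongr : ∫ z in (0 : ℝ)..x, (x - z) ^ (α - 1) * f z =
        ∫ z in (0 : ℝ)..x, -(1 / Real.Gamma (2 - α)) *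
          ((x - z) ^ (α - 1) * ∫ t in (0 : ℝ)..z, (z - t) ^ (1 - α) * g t) := by
      rw [intervalIntegral.integral_of_le hx.1, intervalIntegral.integral_of_le hx.1,
        integral_Ioc_eq_integral_Ioo, integral_Ioc_eq_integral_Ioo]
      refine setIntegral_congr_fun measurableSet_Ioo fun z hz => ?_
      simp only [← hode z ⟨hz.1, hz.2.trans_le hx.2⟩]
      ring
    rw [hcongr, intervalIntegral.integral_const_mul, hsemi]
    field_simp
  intro x hx
  have h1 : (1 : ℝ) ∈ Icc (0 : ℝ) 1 := right_mem_Icc.mpr zero_le_one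
  have hslope := taylor 1 h1
  rw [hu1] at hslope
  rw [integral_caputoGreen_mul hα₁.le hf hx, potential 1 h1, potential x hx, taylor x hx]
  field_simp
  linear_combination -x * hslope
end

section
/- Let γ ∈ (1/2, 1). There exists a constant c > 0, depending only on γ, such that for every u ∈ C¹([0,1]) with u(0) = u(1) = 0 (extended by zero outside [0,1] where needed), one has c·‖u‖²_{H^γ(0,1)} ≤ −∫₀¹ (₀D_x^γ u)(x) · (ₓD₁^γ u)(x) dx, where ‖u‖²_{H^γ(0,1)} = ‖u‖²_{L²(0,1)} + |u|²_{H^γ(0,1)}. -/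
open MeasureTheory Set intervalIntegral

/-- Left Riemann–Liouville derivative of order `γ ∈ (0,1)` based at `0`:
`(₀D_x^γ u)(x) = (1/Γ(1-γ)) d/dx ∫₀ˣ (x-t)^{-γ} u(t) dt`. -/
noncomputable def rlLeft (γ : ℝ) (u : ℝ → ℝ) : ℝ → ℝ :=
  deriv (fun x => (1 / Real.Gamma (1 - γ)) * ∫ t in (0:ℝ)..x, (x - t) ^ (-γ) * u t)

/-- Right Riemann–Liouville derivative of order `γ ∈ (0,1)` based at `1`:
`(ₓD₁^γ u)(x) = -(1/Γ(1-γ)) d/dx ∫ₓ¹ (t-x)^{-γ} u(t) dt`. -/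
noncomputable def rlRight (γ : ℝ) (u : ℝ → ℝ) : ℝ → ℝ :=
  deriv (fun x => -(1 / Real.Gamma (1 - γ)) * ∫ t in x..(1:ℝ), (t - x) ^ (-γ) * u t)

/-- The power `r ↦ r ^ a` on the positive half-line, extended by zero. -/
noncomputable def posPow (a : ℝ) : ℝ → ℝ :=
  (Ioi 0).indicator (fun r => r ^ a)

theorem posPow_of_pos {a r : ℝ} (hr : 0 < r) : posPow a r = r ^ a :=
  indicator_of_mem (mem_Ioi.2 hr) _

theorem posPow_of_nonpos {a r : ℝ} (hr : r ≤ 0) : posPow a r = 0 :=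
  indicator_of_notMem (by simpa using hr) _

theorem posPow_nonneg (a r : ℝ) : 0 ≤ posPow a r :=
  indicator_nonneg (fun _ hx => Real.rpow_nonneg (le_of_lt hx) _) r

@[fun_prop]
theorem measurable_posPow (a : ℝ) : Measurable (posPow a) :=
  (measurable_id.pow_const a).indicator measurableSet_Ioi

theorem integrableOn_rpow_Ioo {a : ℝ} (ha : -1 < a) :
    IntegrableOn (fun r : ℝ => r ^ a) (Ioo 0 1) :=
  ((intervalIntegrable_iff_integrableOn_Ioc_of_le zero_le_one).1
    (intervalIntegrable_rpow' ha)).mono_set Ioo_subset_Ioc_self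

/-- `u` is a continuous function supported in `[0, 1]` whose derivative, off the endpoints, is the
bounded measurable function `v`. -/
structure IsLipPrimitive (u v : ℝ → ℝ) (M : ℝ) : Prop where
  continuous : Continuous u
  hasDerivAt : ∀ x, x ≠ 0 → x ≠ 1 → HasDerivAt u (v x) x
  measurable : Measurable v
  bound : ∀ x, |v x| ≤ M
  deriv_eq_zero : ∀ x, x ∉ Ioo (0 : ℝ) 1 → v x = 0
  eq_zero : ∀ x, x ∉ Ioo (0 : ℝ) 1 → u x = 0

theorem isLipPrimitive_of_hasDerivWithinAt {u u' : ℝ → ℝ}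
    (hd : ∀ x ∈ Icc (0 : ℝ) 1, HasDerivWithinAt u (u' x) (Icc 0 1) x)
    (hc : ContinuousOn u' (Icc 0 1)) (h0 : u 0 = 0) (h1 : u 1 = 0)
    (hout : ∀ x, x ∉ Icc (0 : ℝ) 1 → u x = 0) :
    ∃ M, IsLipPrimitive u ((Ioo 0 1).indicator u') M := by
  obtain ⟨M, hM⟩ := isCompact_Icc.exists_bound_of_continuousOn hc
  have hzero : ∀ x, x ∉ Ioo (0 : ℝ) 1 → u x = 0 := by
    intro x hx
    by_cases hx' : x ∈ Icc (0 : ℝ) 1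
    · rcases eq_or_lt_of_le hx'.1 with h | h
      · rw [← h, h0]
      · rcases eq_or_lt_of_le hx'.2 with h' | h'
        · rw [h', h1]
        · exact absurd ⟨h, h'⟩ hx
    · exact hout x hx'
  have hM0 : 0 ≤ M := (norm_nonneg _).trans (hM 0 (by simp))
  refine ⟨M, ?_, ?_, ?_, ?_, ?_, hzero⟩
  · have hu : u = fun x => u (max 0 (min 1 x)) := by
      funext x
      rcases le_total x 0 with h | h
      · rw [min_eq_right (h.trans zero_le_one), max_eq_left h, h0]
        exact hzero x fun hx => absurd hx.1 (not_lt.2 h)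
      · rcases le_total x 1 with h' | h'
        · rw [min_eq_right h', max_eq_right h]
        · rw [min_eq_left h', max_eq_right zero_le_one, h1]
          exact hzero x fun hx => absurd hx.2 (not_lt.2 h')
    rw [hu]
    have huc : ContinuousOn u (Icc 0 1) := fun x hx => (hd x hx).continuousWithinAt
    exact huc.comp_continuous (by fun_prop) fun x => ⟨le_max_left _ _, by simp⟩
  · intro x hx0 hx1
    by_cases hx : x ∈ Ioo (0 : ℝ) 1
    · rw [indicator_of_mem hx]
      exact (hd x (Ioo_subset_Icc_self hx)).hasDerivAt (Icc_mem_nhds hx.1 hx.2)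
    · rw [indicator_of_notMem hx]
      have hx' : x ∈ (Icc (0 : ℝ) 1)ᶜ := fun h =>
        hx ⟨lt_of_le_of_ne h.1 hx0.symm, lt_of_le_of_ne h.2 hx1⟩
      refine (hasDerivAt_const x (0 : ℝ)).congr_of_eventuallyEq ?_
      filter_upwards [isClosed_Icc.isOpen_compl.mem_nhds hx'] with y hy using hout y hy
  · classical
    rw [← piecewise_eq_indicator]
    exact (hc.mono Ioo_subset_Icc_self).measurable_piecewise continuousOn_const measurableSet_Ioo
  · intro x
    by_cases hx : x ∈ Ioo (0 : ℝ) 1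
    · rw [indicator_of_mem hx]
      exact hM x (Ioo_subset_Icc_self hx)
    · rw [indicator_of_notMem hx, abs_zero]
      exact hM0
  · exact fun x hx => indicator_of_notMem hx _

namespace IsLipPrimitive

variable {u v : ℝ → ℝ} {M : ℝ}

theorem intervalIntegrable (h : IsLipPrimitive u v M) (a b : ℝ) :
    IntervalIntegrable v volume a b :=
  (intervalIntegrable_const (c := M)).mono_fun h.measurable.aestronglyMeasurable
    (.of_forall fun x => (h.bound x).trans (le_abs_self M))

theorem integral_eq_sub (h : IsLipPrimitive u v M) (a b : ℝ) :
    ∫ t in a..b, v t = u b - u a :=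
  integral_eq_of_hasDerivAt_off_countable u v (s := {0, 1}) (by simp) h.continuous.continuousOn
    (fun x hx => h.hasDerivAt x (fun e => hx.2 (by simp [e])) fun e => hx.2 (by simp [e]))
    (h.intervalIntegrable a b)

theorem integral_mul_sub (h : IsLipPrimitive u v M) (a b : ℝ) :
    ∫ s in a..b, v s * (u s - u a) = (u b - u a) ^ 2 / 2 := by
  have hc := h.continuous
  rw [integral_eq_of_hasDerivAt_off_countable (fun s => (u s - u a) ^ 2 / 2) _ (s := {0, 1})
    (by simp) (by fun_prop) (fun x hx => ?_)
    ((h.intervalIntegrable a b).mul_continuousOn (by fun_prop))]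
  · simp
  · have hx' := h.hasDerivAt x (fun e => hx.2 (by simp [e])) fun e => hx.2 (by simp [e])
    refine (((hx'.sub_const (u a)).fun_pow 2).div_const 2).congr_deriv ?_
    norm_num
    ring

theorem dist_le (h : IsLipPrimitive u v M) (a b : ℝ) : |u b - u a| ≤ M * |b - a| := by
  rw [← h.integral_eq_sub a b]
  simpa using norm_integral_le_of_norm_le_const (f := v) (a := a) (b := b) fun x _ => h.bound x

theorem hasDerivAt_integral_rpow_mul (h : IsLipPrimitive u v M) {a : ℝ} (ha : -1 < a)
    {σ : ℝ} (hσ : σ ≠ 0) (x : ℝ) :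
    HasDerivAt (fun x => ∫ r in Ioo (0 : ℝ) 1, r ^ a * u (x - σ * r))
      (∫ r in Ioo (0 : ℝ) 1, r ^ a * v (x - σ * r)) x := by
  have hc := h.continuous
  have hv := h.measurable
  have hint := integrableOn_rpow_Ioo ha
  have hmeas : AEStronglyMeasurable (fun r : ℝ => r ^ a) (volume.restrict (Ioo 0 1)) :=
    hint.aestronglyMeasurable
  have hmeas_u : ∀ y, AEStronglyMeasurable (fun r => u (y - σ * r))
      (volume.restrict (Ioo (0 : ℝ) 1)) := fun y => by
    have : Continuous fun r => u (y - σ * r) := by fun_prop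
    exact this.aestronglyMeasurable
  have hmeas_v : AEStronglyMeasurable (fun r => v (x - σ * r))
      (volume.restrict (Ioo (0 : ℝ) 1)) :=
    (hv.comp (by fun_prop : Measurable fun r => x - σ * r)).aestronglyMeasurable
  have hM0 : 0 ≤ M := (abs_nonneg _).trans (h.bound 0)
  obtain ⟨C, hC⟩ : ∃ C, ∀ y, |u y| ≤ C := by
    refine ⟨M, fun y => ?_⟩
    by_cases hy : y ∈ Ioo (0 : ℝ) 1
    · have h1 := h.dist_le 0 y
      rw [h.eq_zero 0 (by simp), sub_zero, sub_zero, abs_of_pos hy.1] at h1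
      exact h1.trans (mul_le_of_le_one_right hM0 hy.2.le)
    · simpa [h.eq_zero y hy] using hM0
  refine (hasDerivAt_integral_of_dominated_loc_of_lip (μ := volume.restrict (Ioo (0 : ℝ) 1))
    (F := fun x r => r ^ a * u (x - σ * r)) (F' := fun r => r ^ a * v (x - σ * r))
    (bound := fun r => r ^ a * M) (s := univ) Filter.univ_mem
    (.of_forall fun y => hmeas.mul (hmeas_u y)) ?_ (hmeas.mul hmeas_v) ?_ (hint.mul_const M) ?_).2
  · refine (hint.bdd_mul (hmeas_u x) (.of_forall fun r => hC _)).congr ?_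
    exact .of_forall fun r => mul_comm _ _
  · refine (ae_restrict_iff' measurableSet_Ioo).2 (.of_forall fun r hr => ?_)
    have hr0 : (0 : ℝ) ≤ r ^ a := Real.rpow_nonneg hr.1.le a
    refine LipschitzOnWith.of_dist_le_mul fun y _ z _ => ?_
    rw [Real.dist_eq, Real.dist_eq, ← mul_sub, abs_mul, abs_of_nonneg hr0, Real.coe_nnabs,
      abs_of_nonneg (mul_nonneg hr0 hM0), mul_assoc]
    refine mul_le_mul_of_nonneg_left ?_ hr0
    simpa using h.dist_le (z - σ * r) (y - σ * r)
  · have hnull : ∀ c : ℝ, ∀ᵐ r ∂(volume.restrict (Ioo (0 : ℝ) 1)), x - σ * r ≠ c := fun c => by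
      refine ae_restrict_of_ae ?_
      filter_upwards [Measure.ae_ne volume ((x - c) / σ)] with r hr hrc
      exact hr (by field_simp; linarith)
    filter_upwards [hnull 0, hnull 1] with r hr0 hr1
    exact ((h.hasDerivAt _ hr0 hr1).comp_sub_const x (σ * r)).const_mul _

end IsLipPrimitive

theorem integral_Ioo_rpow_mul_sub {f : ℝ → ℝ} (hf : ∀ x, x ∉ Ioo (0 : ℝ) 1 → f x = 0) (a : ℝ)
    {x : ℝ} (hx : x ≤ 1) :
    ∫ r in Ioo (0 : ℝ) 1, r ^ a * f (x - 1 * r) = ∫ t, posPow a (x - t) * f t := by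
  rw [← integral_sub_left_eq_self _ volume x, ← MeasureTheory.integral_indicator measurableSet_Ioo]
  refine integral_congr_ae (.of_forall fun r => ?_)
  simp only [sub_sub_cancel, one_mul]
  by_cases hr : r ∈ Ioo (0 : ℝ) 1
  · rw [indicator_of_mem hr, posPow_of_pos hr.1]
  · rw [indicator_of_notMem hr]
    rcases le_or_gt r 0 with h | h
    · rw [posPow_of_nonpos h, zero_mul]
    · rw [hf _ fun h' => hr ⟨h, by linarith [h'.1]⟩, mul_zero]

theorem integral_Ioo_rpow_mul_add {f : ℝ → ℝ} (hf : ∀ x, x ∉ Ioo (0 : ℝ) 1 → f x = 0) (a : ℝ)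
    {x : ℝ} (hx : 0 ≤ x) :
    ∫ r in Ioo (0 : ℝ) 1, r ^ a * f (x - -1 * r) = ∫ t, posPow a (t - x) * f t := by
  rw [← integral_add_left_eq_self (fun t => posPow a (t - x) * f t) x,
    ← MeasureTheory.integral_indicator measurableSet_Ioo]
  refine integral_congr_ae (.of_forall fun r => ?_)
  simp only [add_sub_cancel_left, neg_mul, one_mul, sub_neg_eq_add]
  by_cases hr : r ∈ Ioo (0 : ℝ) 1
  · rw [indicator_of_mem hr, posPow_of_pos hr.1]
  · rw [indicator_of_notMem hr]
    rcases le_or_gt r 0 with h | h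
    · rw [posPow_of_nonpos h, zero_mul]
    · rw [hf _ fun h' => hr ⟨h, by linarith [h'.2]⟩, mul_zero]

theorem intervalIntegral_left_eq {f : ℝ → ℝ} (hf : ∀ x, x ∉ Ioo (0 : ℝ) 1 → f x = 0) (a : ℝ)
    {x : ℝ} (hx : 0 ≤ x) :
    ∫ t in (0 : ℝ)..x, (x - t) ^ a * f t = ∫ t, posPow a (x - t) * f t := by
  rw [integral_of_le hx, integral_Ioc_eq_integral_Ioo,
    ← MeasureTheory.integral_indicator measurableSet_Ioo]
  refine integral_congr_ae (.of_forall fun t => ?_)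
  by_cases ht : t ∈ Ioo 0 x
  · simp only [indicator_of_mem ht, posPow_of_pos (sub_pos.2 ht.2)]
  · simp only [indicator_of_notMem ht]
    rcases le_or_gt x t with h | h
    · rw [posPow_of_nonpos (sub_nonpos.2 h), zero_mul]
    · rw [hf _ fun h' => ht ⟨h'.1, h⟩, mul_zero]

theorem intervalIntegral_right_eq {f : ℝ → ℝ} (hf : ∀ x, x ∉ Ioo (0 : ℝ) 1 → f x = 0) (a : ℝ)
    {x : ℝ} (hx : x ≤ 1) :
    ∫ t in x..(1 : ℝ), (t - x) ^ a * f t = ∫ t, posPow a (t - x) * f t := by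
  rw [integral_of_le hx, integral_Ioc_eq_integral_Ioo,
    ← MeasureTheory.integral_indicator measurableSet_Ioo]
  refine integral_congr_ae (.of_forall fun t => ?_)
  by_cases ht : t ∈ Ioo x 1
  · simp only [indicator_of_mem ht, posPow_of_pos (sub_pos.2 ht.1)]
  · simp only [indicator_of_notMem ht]
    rcases le_or_gt t x with h | h
    · rw [posPow_of_nonpos (sub_nonpos.2 h), zero_mul]
    · rw [hf _ fun h' => ht ⟨h, h'.2⟩, mul_zero]

namespace IsLipPrimitive

variable {u v : ℝ → ℝ} {M : ℝ}

theorem rlLeft_eq (h : IsLipPrimitive u v M) {γ : ℝ} (hγ : γ < 1) {x : ℝ}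
    (hx : x ∈ Ioo (0 : ℝ) 1) :
    rlLeft γ u x = 1 / Real.Gamma (1 - γ) * ∫ t, posPow (-γ) (x - t) * v t := by
  have hd := (h.hasDerivAt_integral_rpow_mul (by linarith : -1 < -γ) one_ne_zero x).const_mul
    (1 / Real.Gamma (1 - γ))
  rw [integral_Ioo_rpow_mul_sub h.deriv_eq_zero _ hx.2.le] at hd
  refine (hd.congr_of_eventuallyEq ?_).deriv
  filter_upwards [isOpen_Ioo.mem_nhds hx] with y hy
  rw [intervalIntegral_left_eq h.eq_zero _ hy.1.le, integral_Ioo_rpow_mul_sub h.eq_zero _ hy.2.le]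

theorem rlRight_eq (h : IsLipPrimitive u v M) {γ : ℝ} (hγ : γ < 1) {x : ℝ}
    (hx : x ∈ Ioo (0 : ℝ) 1) :
    rlRight γ u x = -(1 / Real.Gamma (1 - γ)) * ∫ t, posPow (-γ) (t - x) * v t := by
  have hd := (h.hasDerivAt_integral_rpow_mul (by linarith : -1 < -γ)
    (neg_ne_zero.2 one_ne_zero) x).const_mul (-(1 / Real.Gamma (1 - γ)))
  rw [integral_Ioo_rpow_mul_add h.deriv_eq_zero _ hx.1.le] at hd
  refine (hd.congr_of_eventuallyEq ?_).deriv
  filter_upwards [isOpen_Ioo.mem_nhds hx] with y hy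
  rw [intervalIntegral_right_eq h.eq_zero _ hy.2.le, integral_Ioo_rpow_mul_add h.eq_zero _ hy.1.le]

theorem neg_integral_rlLeft_mul_rlRight (h : IsLipPrimitive u v M) {γ : ℝ} (hγ : γ < 1) :
    -∫ x in Ioo (0 : ℝ) 1, rlLeft γ u x * rlRight γ u x =
      (1 / Real.Gamma (1 - γ)) ^ 2 * ∫ x, ∫ w : ℝ × ℝ,
        posPow (-γ) (w.1 - x) * posPow (-γ) (x - w.2) * (v w.1 * v w.2) := by
  have hprod : ∀ x, ∫ w : ℝ × ℝ,
        posPow (-γ) (w.1 - x) * posPow (-γ) (x - w.2) * (v w.1 * v w.2) =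
      (∫ s, posPow (-γ) (s - x) * v s) * ∫ t, posPow (-γ) (x - t) * v t := fun x => by
    rw [← integral_prod_mul]
    exact integral_congr_ae (.of_forall fun w => by ring)
  simp_rw [hprod]
  rw [← setIntegral_eq_integral_of_forall_compl_eq_zero (s := Ioo (0 : ℝ) 1)
      (f := fun x => (∫ s, posPow (-γ) (s - x) * v s) * ∫ t, posPow (-γ) (x - t) * v t),
    ← MeasureTheory.integral_const_mul, ← MeasureTheory.integral_neg]
  · refine setIntegral_congr_fun measurableSet_Ioo fun x hx => ?_
    simp only [h.rlLeft_eq hγ hx, h.rlRight_eq hγ hx]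
    ring
  · intro x hx
    rcases le_or_gt x 0 with h0 | h0
    · rw [mul_eq_zero]
      right
      refine integral_eq_zero_of_ae (.of_forall fun t => ?_)
      by_cases ht : t ∈ Ioo (0 : ℝ) 1
      · simp [posPow_of_nonpos (by linarith [ht.1] : x - t ≤ 0)]
      · simp [h.deriv_eq_zero t ht]
    · rw [mul_eq_zero]
      left
      have h1 : 1 ≤ x := not_lt.1 fun h1 => hx ⟨h0, h1⟩
      refine integral_eq_zero_of_ae (.of_forall fun t => ?_)
      by_cases ht : t ∈ Ioo (0 : ℝ) 1
      · simp [posPow_of_nonpos (by linarith [ht.2] : t - x ≤ 0)]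
      · simp [h.deriv_eq_zero t ht]

end IsLipPrimitive

theorem integrable_and_integral_kernel_mul {Z : Type*} [MeasurableSpace Z] {μ : Measure Z}
    [SFinite μ] {K : Z → ℝ × ℝ → ℝ} {k V : ℝ × ℝ → ℝ} {c : ℝ}
    (hK : Measurable (Function.uncurry K)) (hK0 : ∀ z w, 0 ≤ K z w) (hc : 0 ≤ c)
    (hk0 : ∀ w, 0 ≤ k w)
    (hKk : ∀ w, ∫⁻ z, ENNReal.ofReal (K z w) ∂μ = ENNReal.ofReal (c * k w))
    (hV : Measurable V) (hkV : Integrable fun w => k w * V w) :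
    Integrable (fun p : Z × (ℝ × ℝ) => K p.1 p.2 * V p.2) (μ.prod volume) ∧
      ∫ z, (∫ w, K z w * V w) ∂μ = c * ∫ w, k w * V w := by
  have hm : Measurable fun p : Z × (ℝ × ℝ) => K p.1 p.2 * V p.2 :=
    hK.mul (hV.comp measurable_snd)
  have hint : Integrable (fun p : Z × (ℝ × ℝ) => K p.1 p.2 * V p.2) (μ.prod volume) := by
    refine ⟨hm.aestronglyMeasurable, ?_⟩
    rw [hasFiniteIntegral_iff_enorm, lintegral_prod_symm' _ (by fun_prop)]
    have hw : ∀ w, ∫⁻ z, ‖K z w * V w‖ₑ ∂μ = ‖c * (k w * V w)‖ₑ := fun w => by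
      have hKw : Measurable fun z => K z w := hK.comp measurable_prodMk_right
      simp_rw [← mul_assoc c, enorm_mul, Real.enorm_of_nonneg (hK0 _ w)]
      rw [lintegral_mul_const _ (by fun_prop), hKk, ← enorm_mul c,
        Real.enorm_of_nonneg (mul_nonneg hc (hk0 w))]
    simp_rw [hw]
    exact (hkV.const_mul c).hasFiniteIntegral
  refine ⟨hint, ?_⟩
  rw [integral_integral_swap (f := fun z w => K z w * V w) hint,
    ← MeasureTheory.integral_const_mul]
  refine integral_congr_ae (.of_forall fun w => ?_)
  have hKw : Measurable fun z => K z w := hK.comp measurable_prodMk_right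
  simp only [MeasureTheory.integral_mul_const]
  rw [integral_eq_lintegral_of_nonneg_ae (.of_forall fun z => hK0 z w) hKw.aestronglyMeasurable,
    hKk, ENNReal.toReal_ofReal (mul_nonneg hc (hk0 w)), mul_assoc]

theorem posPow_mul {a d : ℝ} (hd : 0 < d) (r : ℝ) : posPow a (d * r) = d ^ a * posPow a r := by
  rcases le_or_gt r 0 with h | h
  · rw [posPow_of_nonpos h, posPow_of_nonpos (mul_nonpos_of_nonneg_of_nonpos hd.le h), mul_zero]
  · rw [posPow_of_pos h, posPow_of_pos (mul_pos hd h), Real.mul_rpow hd.le h.le]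

theorem integrable_posPow_one_sub_mul_posPow {a : ℝ} (ha : -1 < a) :
    Integrable fun r => posPow a (1 - r) * posPow a r := by
  have hb := (intervalIntegrable_iff_integrableOn_Ioc_of_le zero_le_one).1
    (Complex.betaIntegral_convergent (u := (a + 1 : ℝ)) (v := (a + 1 : ℝ))
      (by simp; linarith) (by simp; linarith)).norm
  rw [integrableOn_Ioc_iff_integrableOn_Ioo] at hb
  refine (hb.congr_fun (g := fun r => posPow a (1 - r) * posPow a r) ?_
    measurableSet_Ioo).integrable_of_forall_notMem_eq_zero ?_
  · intro r hr
    have h1 : (1 - r : ℂ) = ((1 - r : ℝ) : ℂ) := by push_cast; ring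
    have h2 : (((a + 1 : ℝ) : ℂ) - 1).re = a := by simp
    dsimp only
    rw [norm_mul, h1, Complex.norm_cpow_eq_rpow_re_of_pos hr.1,
      Complex.norm_cpow_eq_rpow_re_of_pos (sub_pos.2 hr.2), h2, posPow_of_pos hr.1,
      posPow_of_pos (sub_pos.2 hr.2), mul_comm]
  · intro r hr
    rcases le_or_gt r 0 with h | h
    · rw [posPow_of_nonpos h, mul_zero]
    · rw [posPow_of_nonpos (sub_nonpos.2 (not_lt.1 fun h' => hr ⟨h, h'⟩)), zero_mul]

theorem integral_posPow_one_sub_mul_posPow_pos {a : ℝ} (ha : -1 < a) :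
    0 < ∫ r, posPow a (1 - r) * posPow a r := by
  rw [integral_pos_iff_support_of_nonneg
    (fun r => mul_nonneg (posPow_nonneg _ _) (posPow_nonneg _ _))
    (integrable_posPow_one_sub_mul_posPow ha)]
  refine lt_of_lt_of_le (by simp : 0 < volume (Ioo (0 : ℝ) 1)) (measure_mono fun r hr => ?_)
  rw [Function.mem_support, posPow_of_pos hr.1, posPow_of_pos (sub_pos.2 hr.2)]
  exact (mul_pos (Real.rpow_pos_of_pos (sub_pos.2 hr.2) _) (Real.rpow_pos_of_pos hr.1 _)).ne'

theorem lintegral_posPow_sub_mul_posPow_sub {a : ℝ} (ha : -1 < a) (s t : ℝ) :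
    ∫⁻ x, ENNReal.ofReal (posPow a (s - x) * posPow a (x - t)) =
      ENNReal.ofReal ((∫ r, posPow a (1 - r) * posPow a r) * posPow (2 * a + 1) (s - t)) := by
  rcases le_or_gt s t with hst | hst
  · rw [posPow_of_nonpos (sub_nonpos.2 hst), mul_zero, ENNReal.ofReal_zero]
    refine (lintegral_congr fun x => ?_).trans lintegral_zero
    rcases le_or_gt s x with h | h
    · simp [posPow_of_nonpos (sub_nonpos.2 h)]
    · simp [posPow_of_nonpos (sub_nonpos.2 (h.le.trans hst))]
  · have hd : 0 < s - t := sub_pos.2 hst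
    set φ : ℝ → ℝ := fun r => posPow a (1 - r) * posPow a r with hφ
    have hscale : ∀ x, posPow a (s - x) * posPow a (x - t) =
        (s - t) ^ (2 * a) * φ ((x - t) / (s - t)) := fun x => by
      have h1 : s - x = (s - t) * (1 - (x - t) / (s - t)) := by field_simp; ring
      have h2 : x - t = (s - t) * ((x - t) / (s - t)) := by field_simp
      rw [h1, posPow_mul hd, hφ, two_mul, Real.rpow_add hd]
      conv_lhs => rw [h2, posPow_mul hd]
      have h3 : (s - t) * ((x - t) / (s - t)) / (s - t) = (x - t) / (s - t) := by field_simp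
      rw [h3]
      ring
    have hφi : Integrable fun x => φ ((x - t) / (s - t)) :=
      ((integrable_posPow_one_sub_mul_posPow ha).comp_div hd.ne').comp_sub_right t
    simp_rw [hscale]
    rw [← ofReal_integral_eq_lintegral_ofReal (hφi.const_mul _) (.of_forall fun x => mul_nonneg
        (Real.rpow_nonneg hd.le _) (mul_nonneg (posPow_nonneg _ _) (posPow_nonneg _ _))),
      MeasureTheory.integral_const_mul,
      integral_sub_right_eq_self (fun x => φ (x / (s - t))) t, Measure.integral_comp_div,
      posPow_of_pos hd, Real.rpow_add hd, Real.rpow_one, abs_of_pos hd, smul_eq_mul]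
    ring_nf

theorem lintegral_posPow_tail {b d : ℝ} (hb : b < -1) (hd : 0 < d) :
    ∫⁻ y, ENNReal.ofReal (posPow 0 (y - d) * posPow b y) =
      ENNReal.ofReal (-d ^ (b + 1) / (b + 1)) := by
  have heq : ∀ y, ENNReal.ofReal (posPow 0 (y - d) * posPow b y) =
      (Ioi d).indicator (fun y => ENNReal.ofReal (y ^ b)) y := fun y => by
    by_cases hy : d < y
    · rw [indicator_of_mem (mem_Ioi.2 hy), posPow_of_pos (sub_pos.2 hy), Real.rpow_zero, one_mul,
        posPow_of_pos (hd.trans hy)]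
    · rw [indicator_of_notMem (by simpa using hy), posPow_of_nonpos (by linarith), zero_mul,
        ENNReal.ofReal_zero]
  simp_rw [heq]
  rw [lintegral_indicator measurableSet_Ioi, ← integral_Ioi_rpow_of_lt hb hd,
    ofReal_integral_eq_lintegral_ofReal (integrableOn_Ioi_rpow_of_lt hb hd)]
  exact (ae_restrict_iff' measurableSet_Ioi).2
    (.of_forall fun y hy => Real.rpow_nonneg (hd.trans hy).le _)

/-- The kernel `(y - x) ^ a` restricted to the configurations `x < t < s < y`, where
`z = (x, y)` and `w = (s, t)`. -/
noncomputable def nestedKernel (a : ℝ) (z w : ℝ × ℝ) : ℝ :=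
  posPow 0 (w.1 - w.2) * (posPow 0 (w.2 - z.1) * (posPow 0 (z.2 - w.1) * posPow a (z.2 - z.1)))

theorem measurable_nestedKernel (a : ℝ) : Measurable (Function.uncurry (nestedKernel a)) := by
  unfold nestedKernel Function.uncurry
  fun_prop

theorem nestedKernel_nonneg (a : ℝ) (z w : ℝ × ℝ) : 0 ≤ nestedKernel a z w :=
  mul_nonneg (posPow_nonneg _ _) (mul_nonneg (posPow_nonneg _ _)
    (mul_nonneg (posPow_nonneg _ _) (posPow_nonneg _ _)))

theorem lintegral_nestedKernel {a : ℝ} (ha : a < -2) (w : ℝ × ℝ) :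
    ∫⁻ z, ENNReal.ofReal (nestedKernel a z w) =
      ENNReal.ofReal (1 / ((a + 1) * (a + 2)) * posPow (a + 2) (w.1 - w.2)) := by
  obtain ⟨s, t⟩ := w
  rcases le_or_gt s t with hst | hst
  · simp [nestedKernel, posPow_of_nonpos (sub_nonpos.2 hst)]
  have hd : 0 < s - t := sub_pos.2 hst
  have hmeas : Measurable fun z => ENNReal.ofReal (nestedKernel a z (s, t)) :=
    ((measurable_nestedKernel a).comp measurable_prodMk_right).ennreal_ofReal
  have ha1 : 0 < -1 / (a + 1) := div_pos_of_neg_of_neg (by norm_num) (by linarith)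
  rw [Measure.volume_eq_prod, lintegral_prod _ hmeas.aemeasurable]
  have hinner : ∀ x, ∫⁻ y, ENNReal.ofReal (nestedKernel a (x, y) (s, t)) =
      ENNReal.ofReal (-1 / (a + 1)) *
        ENNReal.ofReal (posPow 0 (t - x) * posPow (a + 1) (s - x)) := fun x => by
    simp only [nestedKernel, posPow_of_pos hd, Real.rpow_zero, one_mul]
    rcases le_or_gt t x with hx | hx
    · simp [posPow_of_nonpos (sub_nonpos.2 hx)]
    · have hsx : 0 < s - x := by linarith
      simp only [posPow_of_pos (sub_pos.2 hx), Real.rpow_zero, one_mul]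
      rw [← lintegral_add_right_eq_self _ x]
      simp only [add_sub_cancel_right]
      have := lintegral_posPow_tail (by linarith : a < -1) hsx
      simp only [sub_sub_eq_add_sub] at this
      rw [this, posPow_of_pos hsx, ← ENNReal.ofReal_mul ha1.le]
      congr 1
      ring
  simp_rw [hinner]
  rw [lintegral_const_mul _ (by fun_prop), ← lintegral_sub_left_eq_self _ s]
  simp only [sub_sub_cancel]
  have := lintegral_posPow_tail (by linarith : a + 1 < -1) hd
  have hshift : ∀ y : ℝ, t - (s - y) = y - (s - t) := fun y => by ring
  simp_rw [hshift]
  rw [this, posPow_of_pos hd, ← ENNReal.ofReal_mul ha1.le]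
  have h1 : a + 1 ≠ 0 := by linarith
  have h2 : a + 2 ≠ 0 := by linarith
  have h3 : a + 1 + 1 = a + 2 := by ring
  rw [h3]
  congr 1
  field_simp

theorem integral_posPow_zero_mul (f : ℝ → ℝ) (a b : ℝ) :
    ∫ t, posPow 0 (b - t) * (posPow 0 (t - a) * f t) = posPow 0 (b - a) * ∫ t in a..b, f t := by
  rcases le_or_gt b a with hab | hab
  · rw [posPow_of_nonpos (sub_nonpos.2 hab), zero_mul]
    refine integral_eq_zero_of_ae (.of_forall fun t => ?_)
    rcases le_or_gt b t with h | h
    · simp [posPow_of_nonpos (sub_nonpos.2 h)]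
    · simp [posPow_of_nonpos (sub_nonpos.2 (h.le.trans hab))]
  · rw [posPow_of_pos (sub_pos.2 hab), Real.rpow_zero, one_mul, integral_of_le hab.le,
      integral_Ioc_eq_integral_Ioo, ← MeasureTheory.integral_indicator measurableSet_Ioo]
    refine integral_congr_ae (.of_forall fun t => ?_)
    by_cases ht : t ∈ Ioo a b
    · simp [indicator_of_mem ht, posPow_of_pos (sub_pos.2 ht.1), posPow_of_pos (sub_pos.2 ht.2)]
    · simp only [indicator_of_notMem ht]
      rcases le_or_gt t a with h | h
      · rw [posPow_of_nonpos (sub_nonpos.2 h), zero_mul, mul_zero]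
      · rw [posPow_of_nonpos (sub_nonpos.2 (not_lt.1 fun h' => ht ⟨h, h'⟩)), zero_mul]

theorem abs_posPow_zero_le (r : ℝ) : |posPow 0 r| ≤ 1 := by
  rcases le_or_gt r 0 with h | h
  · simp [posPow_of_nonpos h]
  · simp [posPow_of_pos h]

namespace IsLipPrimitive

variable {u v : ℝ → ℝ} {M : ℝ}

theorem integrable (h : IsLipPrimitive u v M) : Integrable v :=
  ((intervalIntegrable_iff_integrableOn_Ioo_of_le zero_le_one).1
    (h.intervalIntegrable 0 1)).integrable_of_forall_notMem_eq_zero h.deriv_eq_zero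

theorem integrable_posPow_mul (h : IsLipPrimitive u v M) {b : ℝ} (hb : -1 < b) :
    Integrable fun w : ℝ × ℝ => posPow b (w.1 - w.2) * (v w.1 * v w.2) := by
  have hP : Integrable ((Ioo (0 : ℝ) 1).indicator fun r => r ^ b) :=
    (integrableOn_rpow_Ioo hb).integrable_indicator measurableSet_Ioo
  have hconv := h.integrable.convolution_integrand (ContinuousLinearMap.mul ℝ ℝ) hP
  have hv1 : Measurable fun w : ℝ × ℝ => v w.1 := h.measurable.comp measurable_fst
  refine (hconv.bdd_mul (c := M) (f := fun w : ℝ × ℝ => v w.1) hv1.aestronglyMeasurable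
    (.of_forall fun w => h.bound _)).congr (.of_forall fun w => ?_)
  simp only [ContinuousLinearMap.mul_apply']
  by_cases hw : w.1 - w.2 ∈ Ioo (0 : ℝ) 1
  · rw [indicator_of_mem hw, posPow_of_pos hw.1]
    ring
  · rw [indicator_of_notMem hw]
    rcases le_or_gt (w.1 - w.2) 0 with h0 | h0
    · simp [posPow_of_nonpos h0]
    · have h1 : 1 ≤ w.1 - w.2 := not_lt.1 fun h1 => hw ⟨h0, h1⟩
      by_cases hw2 : w.2 ∈ Ioo (0 : ℝ) 1
      · simp [h.deriv_eq_zero w.1 fun hw1 => by linarith [hw1.2, hw2.1]]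
      · simp [h.deriv_eq_zero w.2 hw2]

theorem integral_nestedKernel_mul (h : IsLipPrimitive u v M) (a : ℝ) (z : ℝ × ℝ) :
    ∫ w : ℝ × ℝ, nestedKernel a z w * (v w.1 * v w.2) =
      posPow a (z.2 - z.1) * ((u z.2 - u z.1) ^ 2 / 2) := by
  obtain ⟨x, y⟩ := z
  have hint : Integrable fun w : ℝ × ℝ => posPow 0 (w.1 - w.2) * (posPow 0 (w.2 - x) *
      (posPow 0 (y - w.1) * (v w.1 * v w.2))) := by
    have hbdd : ∀ {p : ℝ × ℝ → ℝ} {f : ℝ × ℝ → ℝ}, Measurable p → Integrable f →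
        Integrable fun w => posPow 0 (p w) * f w := fun hp hf =>
      hf.bdd_mul ((measurable_posPow 0).comp hp).aestronglyMeasurable
        (.of_forall fun w => abs_posPow_zero_le _)
    exact hbdd (by fun_prop) (hbdd (by fun_prop) (hbdd (by fun_prop)
      (h.integrable.mul_prod h.integrable)))
  have hsplit : ∀ w : ℝ × ℝ, nestedKernel a (x, y) w * (v w.1 * v w.2) =
      posPow a (y - x) * (posPow 0 (w.1 - w.2) * (posPow 0 (w.2 - x) *
        (posPow 0 (y - w.1) * (v w.1 * v w.2)))) := fun w => by
    simp only [nestedKernel]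
    ring
  have hinner : ∀ s, ∫ t, posPow 0 (s - t) * (posPow 0 (t - x) * (posPow 0 (y - s) *
      (v s * v t))) = posPow 0 (y - s) * (posPow 0 (s - x) * (v s * (u s - u x))) := fun s => by
    rw [integral_posPow_zero_mul, intervalIntegral.integral_const_mul,
      intervalIntegral.integral_const_mul, h.integral_eq_sub]
    ring
  simp_rw [hsplit]
  rw [MeasureTheory.integral_const_mul, Measure.volume_eq_prod, integral_prod _ hint]
  simp only [hinner]
  rw [integral_posPow_zero_mul, h.integral_mul_sub]
  rcases le_or_gt (y - x) 0 with hxy | hxy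
  · simp [posPow_of_nonpos hxy]
  · rw [posPow_of_pos (a := 0) hxy, Real.rpow_zero, one_mul]

theorem integrable_and_integral_posPow_mul_sq (h : IsLipPrimitive u v M) {a : ℝ} (ha : -3 < a)
    (ha' : a < -2) :
    Integrable (fun z : ℝ × ℝ => posPow a (z.2 - z.1) * ((u z.2 - u z.1) ^ 2 / 2)) ∧
      ∫ z : ℝ × ℝ, posPow a (z.2 - z.1) * ((u z.2 - u z.1) ^ 2 / 2) =
        1 / ((a + 1) * (a + 2)) *
          ∫ w : ℝ × ℝ, posPow (a + 2) (w.1 - w.2) * (v w.1 * v w.2) := by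
  have hv := h.measurable
  obtain ⟨hi, he⟩ := integrable_and_integral_kernel_mul (μ := (volume : Measure (ℝ × ℝ)))
    (V := fun w => v w.1 * v w.2) (measurable_nestedKernel a) (nestedKernel_nonneg a)
    (one_div_nonneg.2 (mul_nonneg_of_nonpos_of_nonpos (by linarith) (by linarith)))
    (fun w => posPow_nonneg _ _) (lintegral_nestedKernel ha') (by fun_prop)
    (h.integrable_posPow_mul (by linarith))
  simp only [h.integral_nestedKernel_mul] at he
  refine ⟨?_, he⟩
  simpa only [h.integral_nestedKernel_mul] using hi.integral_prod_left

theorem integral_product_posPow (h : IsLipPrimitive u v M) {a : ℝ} (ha : -1 < a) :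
    ∫ x, ∫ w : ℝ × ℝ, posPow a (w.1 - x) * posPow a (x - w.2) * (v w.1 * v w.2) =
      (∫ r, posPow a (1 - r) * posPow a r) *
        ∫ w : ℝ × ℝ, posPow (2 * a + 1) (w.1 - w.2) * (v w.1 * v w.2) := by
  have hv := h.measurable
  refine (integrable_and_integral_kernel_mul (μ := (volume : Measure ℝ))
    (K := fun x w => posPow a (w.1 - x) * posPow a (x - w.2))
    (V := fun w => v w.1 * v w.2) ?_ (fun x w => mul_nonneg (posPow_nonneg _ _)
      (posPow_nonneg _ _)) (integral_posPow_one_sub_mul_posPow_pos ha).le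
    (fun w => posPow_nonneg _ _) (fun w => lintegral_posPow_sub_mul_posPow_sub ha w.1 w.2)
    (by fun_prop) (h.integrable_posPow_mul (by linarith))).2
  unfold Function.uncurry
  fun_prop

end IsLipPrimitive

theorem sq_div_abs_rpow_eq (u : ℝ → ℝ) (γ x y : ℝ) :
    (u x - u y) ^ 2 / |x - y| ^ (1 + 2 * γ) =
      2 * (posPow (-1 - 2 * γ) (y - x) * ((u y - u x) ^ 2 / 2) +
        posPow (-1 - 2 * γ) (x - y) * ((u x - u y) ^ 2 / 2)) := by
  have hexp : -1 - 2 * γ = -(1 + 2 * γ) := by ring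
  rcases lt_trichotomy x y with hxy | rfl | hxy
  · rw [abs_sub_comm, abs_of_pos (sub_pos.2 hxy), posPow_of_pos (sub_pos.2 hxy),
      posPow_of_nonpos (sub_nonpos.2 hxy.le), hexp, Real.rpow_neg (sub_pos.2 hxy).le]
    ring
  · simp
  · rw [abs_of_pos (sub_pos.2 hxy), posPow_of_pos (sub_pos.2 hxy),
      posPow_of_nonpos (sub_nonpos.2 hxy.le), hexp, Real.rpow_neg (sub_pos.2 hxy).le]
    ring

theorem integral_sq_div_abs_rpow_eq {u : ℝ → ℝ} {γ : ℝ}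
    (hg : Integrable fun z : ℝ × ℝ =>
      posPow (-1 - 2 * γ) (z.2 - z.1) * ((u z.2 - u z.1) ^ 2 / 2)) (s : Set ℝ) :
    ∫ x in s, ∫ y in s, (u x - u y) ^ 2 / |x - y| ^ (1 + 2 * γ) =
      4 * ∫ z in s ×ˢ s, posPow (-1 - 2 * γ) (z.2 - z.1) * ((u z.2 - u z.1) ^ 2 / 2) := by
  set g : ℝ × ℝ → ℝ := fun z => posPow (-1 - 2 * γ) (z.2 - z.1) * ((u z.2 - u z.1) ^ 2 / 2)
  have hgs : Integrable fun z : ℝ × ℝ => g z.swap := hg.swap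
  have hf : ∀ x y, (u x - u y) ^ 2 / |x - y| ^ (1 + 2 * γ) =
      2 * (g (x, y) + g (x, y).swap) := fun x y => sq_div_abs_rpow_eq u γ x y
  simp_rw [hf]
  rw [← setIntegral_prod (fun z => 2 * (g z + g z.swap))
    (((hg.add hgs).const_mul 2).integrableOn), ← Measure.volume_eq_prod,
    MeasureTheory.integral_const_mul, integral_add hg.integrableOn hgs.integrableOn,
    Measure.volume_eq_prod, setIntegral_prod_swap s s g]
  ring

namespace IsLipPrimitive

variable {u v : ℝ → ℝ} {M : ℝ}

theorem const_mul_integral_sq_le (h : IsLipPrimitive u v M) {a : ℝ} (ha : a ≤ 0)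
    (hg : Integrable fun z : ℝ × ℝ => posPow a (z.2 - z.1) * ((u z.2 - u z.1) ^ 2 / 2)) :
    2 ^ a / 2 * ∫ x in Ioo (0 : ℝ) 1, u x ^ 2 ≤
      ∫ z in Ioo (0 : ℝ) 1 ×ˢ Ioo (1 : ℝ) 2,
        posPow a (z.2 - z.1) * ((u z.2 - u z.1) ^ 2 / 2) := by
  have hu2 : IntegrableOn (fun x => u x ^ 2) (Ioo (0 : ℝ) 1) :=
    ((h.continuous.pow 2).continuousOn.integrableOn_compact isCompact_Icc).mono_set
      Ioo_subset_Icc_self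
  have hone : IntegrableOn (fun _ : ℝ => (1 : ℝ)) (Ioo (1 : ℝ) 2) := by simp
  have hprod : IntegrableOn (fun z : ℝ × ℝ => u z.1 ^ 2 * 1) (Ioo (0 : ℝ) 1 ×ˢ Ioo (1 : ℝ) 2) := by
    have := Integrable.mul_prod hu2 hone
    rwa [Measure.prod_restrict, ← Measure.volume_eq_prod] at this
  have hval : ∫ z in Ioo (0 : ℝ) 1 ×ˢ Ioo (1 : ℝ) 2, u z.1 ^ 2 * 1 =
      ∫ x in Ioo (0 : ℝ) 1, u x ^ 2 := by
    rw [Measure.volume_eq_prod, setIntegral_prod_mul (fun x => u x ^ 2) (fun _ => (1 : ℝ))]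
    norm_num
  rw [← hval, ← MeasureTheory.integral_const_mul]
  refine setIntegral_mono_on (hprod.const_mul _) hg.integrableOn
    (measurableSet_Ioo.prod measurableSet_Ioo) ?_
  rintro ⟨x, y⟩ ⟨⟨hx0, hx1⟩, hy1, hy2⟩
  dsimp only at *
  have hxy : 0 < y - x := by linarith
  rw [posPow_of_pos hxy, h.eq_zero y fun hy => by linarith [hy.2]]
  have := Real.rpow_le_rpow_of_nonpos hxy (by linarith : y - x ≤ 2) ha
  nlinarith [mul_le_mul_of_nonneg_right this (sq_nonneg (u x))]

theorem const_mul_sobolev_le (h : IsLipPrimitive u v M) {γ : ℝ} (hγ : 1 / 2 < γ)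
    (hg : Integrable fun z : ℝ × ℝ =>
      posPow (-1 - 2 * γ) (z.2 - z.1) * ((u z.2 - u z.1) ^ 2 / 2)) :
    2 ^ (-1 - 2 * γ) / 2 * ((∫ x in Ioo (0 : ℝ) 1, u x ^ 2) +
        ∫ x in Ioo (0 : ℝ) 1, ∫ y in Ioo (0 : ℝ) 1, (u x - u y) ^ 2 / |x - y| ^ (1 + 2 * γ)) ≤
      ∫ z : ℝ × ℝ, posPow (-1 - 2 * γ) (z.2 - z.1) * ((u z.2 - u z.1) ^ 2 / 2) := by
  have hL2 := h.const_mul_integral_sq_le (by linarith : -1 - 2 * γ ≤ 0) hg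
  rw [integral_sq_div_abs_rpow_eq hg]
  set g : ℝ × ℝ → ℝ := fun z => posPow (-1 - 2 * γ) (z.2 - z.1) * ((u z.2 - u z.1) ^ 2 / 2)
  have hg0 : ∀ z, 0 ≤ g z := fun z => mul_nonneg (posPow_nonneg _ _) (by positivity)
  have hunion : (∫ z in Ioo (0 : ℝ) 1 ×ˢ Ioo (0 : ℝ) 1, g z) +
      ∫ z in Ioo (0 : ℝ) 1 ×ˢ Ioo (1 : ℝ) 2, g z ≤ ∫ z, g z := by
    rw [← setIntegral_union _ (measurableSet_Ioo.prod measurableSet_Ioo) hg.integrableOn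
      hg.integrableOn]
    · exact setIntegral_le_integral hg (.of_forall hg0)
    · exact disjoint_left.2 fun z hz hz' => lt_asymm hz.2.2 hz'.2.1
  have hS : 0 ≤ ∫ z in Ioo (0 : ℝ) 1 ×ˢ Ioo (0 : ℝ) 1, g z := integral_nonneg hg0
  have hpow : (2 : ℝ) ^ (-1 - 2 * γ) ≤ 2⁻¹ := by
    rw [← Real.rpow_neg_one]
    exact Real.rpow_le_rpow_of_exponent_le one_le_two (by linarith)
  nlinarith [mul_le_mul_of_nonneg_right hpow hS]

end IsLipPrimitive

theorem stmt_8 (γ : ℝ) (hγ₁ : 1/2 < γ) (hγ₂ : γ < 1) :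
    ∃ c > (0:ℝ), ∀ u u' : ℝ → ℝ,
      -- `u ∈ C¹([0,1])` with derivative `u'` on `[0,1]` ...
      (∀ x ∈ Set.Icc (0:ℝ) 1, HasDerivWithinAt u (u' x) (Set.Icc 0 1) x) →
      ContinuousOn u' (Set.Icc 0 1) →
      -- ... `u(0) = u(1) = 0`, extended by zero outside `[0,1]`:
      u 0 = 0 → u 1 = 0 → (∀ x, x ∉ Set.Icc (0:ℝ) 1 → u x = 0) →
      c * ((∫ x in Set.Ioo (0:ℝ) 1, u x ^ 2) +
            ∫ x in Set.Ioo (0:ℝ) 1, ∫ y in Set.Ioo (0:ℝ) 1,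
              (u x - u y) ^ 2 / |x - y| ^ (1 + 2 * γ))
        ≤ - ∫ x in Set.Ioo (0:ℝ) 1, rlLeft γ u x * rlRight γ u x := by
  have hΓ : 0 < Real.Gamma (1 - γ) := Real.Gamma_pos_of_pos (by linarith)
  have hB := integral_posPow_one_sub_mul_posPow_pos (by linarith : -1 < -γ)
  set B := ∫ r, posPow (-γ) (1 - r) * posPow (-γ) r
  have hD : 0 < 2 * γ * (2 * γ - 1) := mul_pos (by linarith) (by linarith)
  have hC : 0 < (1 / Real.Gamma (1 - γ)) ^ 2 * B * (2 * γ * (2 * γ - 1)) := by positivity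
  refine ⟨(1 / Real.Gamma (1 - γ)) ^ 2 * B * (2 * γ * (2 * γ - 1)) * (2 ^ (-1 - 2 * γ) / 2),
    by positivity, fun u u' hd hc h0 h1 hout => ?_⟩
  obtain ⟨M, h⟩ := isLipPrimitive_of_hasDerivWithinAt hd hc h0 h1 hout
  obtain ⟨hg, hgJ⟩ := h.integrable_and_integral_posPow_mul_sq (by linarith : -3 < -1 - 2 * γ)
    (by linarith)
  rw [h.neg_integral_rlLeft_mul_rlRight hγ₂, h.integral_product_posPow (by linarith), mul_assoc]
  refine (mul_le_mul_of_nonneg_left (h.const_mul_sobolev_le hγ₁ hg) hC.le).trans_eq ?_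
  rw [hgJ, show -1 - 2 * γ + 2 = 2 * -γ + 1 by ring,
    show (-1 - 2 * γ + 1) * (2 * -γ + 1) = 2 * γ * (2 * γ - 1) by ring]
  have hcancel : ∀ K D J : ℝ, D ≠ 0 → K ^ 2 * B * D * (1 / D * J) = K ^ 2 * (B * J) := by
    intro K D J hD
    field_simp
  exact hcancel _ _ _ hD.ne'
end

section
/- Let 1 < α < 2 and let u, v : ℝ → ℝ be smooth functions compactly supported in (0,1). Then ∫₀¹ (₀D_x^α u)(x) · v(x) dx = ∫₀¹ (₀D_x^{α/2} u)(x) · (ₓD₁^{α/2} v)(x) dx; that is, the bilinear form A(u,v) = −⟨₀D_x^α u, v⟩ satisfies A(u,v) = −⟨₀D_x^{α/2} u, ₓD₁^{α/2} v⟩. -/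
open MeasureTheory Set intervalIntegral

open scoped Convolution

/-- The Riemann–Liouville kernel `x₊ ^ (σ - 1) / Γ(σ)`. -/
noncomputable def rlKernel (σ : ℝ) : ℝ → ℝ :=
  (Ioi 0).indicator fun x => (Real.Gamma σ)⁻¹ * x ^ (σ - 1)

lemma rlKernel_of_pos (σ : ℝ) {x : ℝ} (hx : 0 < x) :
    rlKernel σ x = (Real.Gamma σ)⁻¹ * x ^ (σ - 1) :=
  indicator_of_mem (mem_Ioi.2 hx) _

lemma rlKernel_of_nonpos (σ : ℝ) {x : ℝ} (hx : x ≤ 0) : rlKernel σ x = 0 :=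
  indicator_of_notMem (notMem_Ioi.2 hx) _

lemma rlKernel_nonneg {σ : ℝ} (hσ : 0 < σ) (x : ℝ) : 0 ≤ rlKernel σ x :=
  indicator_nonneg (fun _ hy => mul_nonneg (inv_nonneg.2 (Real.Gamma_pos_of_pos hσ).le)
    (Real.rpow_nonneg (le_of_lt hy) _)) x

lemma locallyIntegrable_rlKernel {σ : ℝ} (hσ : 0 < σ) :
    LocallyIntegrable (rlKernel σ) := by
  have h : ∀ a b : ℝ, IntervalIntegrable (fun x : ℝ => (Real.Gamma σ)⁻¹ * x ^ (σ - 1)) volume a b :=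
    fun a b => (intervalIntegrable_rpow' (by linarith)).const_mul _
  refine LocallyIntegrable.indicator ?_ measurableSet_Ioi
  intro x
  refine ⟨Ioc (x - 1) (x + 1), Ioc_mem_nhds (by linarith) (by linarith), ?_⟩
  exact (intervalIntegrable_iff_integrableOn_Ioc_of_le (by linarith)).1 (h _ _)

lemma integral_rpow_mul_sub_rpow_s10 {σ τ a : ℝ} (hσ : 0 < σ) (hτ : 0 < τ) (ha : 0 < a) :
    ∫ x in (0 : ℝ)..a, x ^ (σ - 1) * (a - x) ^ (τ - 1) =
      a ^ (σ + τ - 1) * (Real.Gamma σ * Real.Gamma τ / Real.Gamma (σ + τ)) := by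
  have h := Complex.betaIntegral_scaled (σ : ℂ) (τ : ℂ) ha
  have hG : Complex.Gamma (σ + τ) ≠ 0 :=
    Complex.Gamma_ne_zero_of_re_pos (by simpa using add_pos hσ hτ)
  have hB : Complex.betaIntegral σ τ =
      Complex.Gamma σ * Complex.Gamma τ / Complex.Gamma (σ + τ) := by
    rw [Complex.Gamma_mul_Gamma_eq_betaIntegral (by simpa using hσ) (by simpa using hτ),
      mul_div_cancel_left₀ _ hG]
  rw [hB] at h
  apply Complex.ofReal_injective
  rw [← intervalIntegral.integral_ofReal]
  have hc : ∀ x ∈ uIcc 0 a, ((x ^ (σ - 1) * (a - x) ^ (τ - 1) : ℝ) : ℂ) =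
      (x : ℂ) ^ ((σ : ℂ) - 1) * ((a : ℂ) - x) ^ ((τ : ℂ) - 1) := by
    intro x hx
    rw [uIcc_of_le ha.le] at hx
    rw [Complex.ofReal_mul, Complex.ofReal_cpow hx.1, Complex.ofReal_cpow (sub_nonneg.2 hx.2)]
    push_cast
    rfl
  rw [intervalIntegral.integral_congr hc, h, Complex.ofReal_mul, Complex.ofReal_cpow ha.le,
    Complex.ofReal_div, Complex.ofReal_mul, ← Complex.Gamma_ofReal, ← Complex.Gamma_ofReal,
    ← Complex.Gamma_ofReal]
  push_cast
  rfl

lemma rlKernel_mul_rlKernel_sub (σ τ : ℝ) (y : ℝ) :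
    (fun t => rlKernel σ t * rlKernel τ (y - t)) = (Ioo 0 y).indicator
      fun t => ((Real.Gamma σ)⁻¹ * (Real.Gamma τ)⁻¹) * (t ^ (σ - 1) * (y - t) ^ (τ - 1)) := by
  ext t
  by_cases ht : t ∈ Ioo 0 y
  · rw [indicator_of_mem ht, rlKernel_of_pos _ ht.1, rlKernel_of_pos _ (sub_pos.2 ht.2)]
    ring
  · rw [indicator_of_notMem ht]
    rcases le_or_gt t 0 with h0 | h0
    · rw [rlKernel_of_nonpos _ h0, zero_mul]
    · rw [rlKernel_of_nonpos τ (sub_nonpos.2 (not_lt.1 fun h => ht ⟨h0, h⟩)), mul_zero]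

lemma convolutionExists_rlKernel {σ τ : ℝ} (hσ : 0 < σ) (hτ : 0 < τ) :
    ConvolutionExists (rlKernel σ) (rlKernel τ) (ContinuousLinearMap.mul ℝ ℝ) volume := by
  intro y
  change Integrable (fun t => rlKernel σ t * rlKernel τ (y - t)) volume
  rw [rlKernel_mul_rlKernel_sub, integrable_indicator_iff measurableSet_Ioo]
  rcases le_or_gt y 0 with hy | hy
  · simp [Ioo_eq_empty (not_lt.2 hy)]
  · refine Integrable.const_mul ?_ _
    refine IntegrableOn.mono_set ((intervalIntegrable_iff_integrableOn_Ioc_of_le hy.le).1 ?_)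
      Ioo_subset_Ioc_self
    refine not_imp_comm.1 intervalIntegral.integral_undef ?_
    rw [integral_rpow_mul_sub_rpow_s10 hσ hτ hy]
    have := Real.Gamma_pos_of_pos hσ
    have := Real.Gamma_pos_of_pos hτ
    have := Real.Gamma_pos_of_pos (add_pos hσ hτ)
    positivity

/-- Semigroup property of the Riemann–Liouville kernels. -/
lemma rlKernel_convolution_rlKernel {σ τ : ℝ} (hσ : 0 < σ) (hτ : 0 < τ) :
    rlKernel σ ⋆[ContinuousLinearMap.mul ℝ ℝ, volume] rlKernel τ = rlKernel (σ + τ) := by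
  ext y
  change ∫ t, rlKernel σ t * rlKernel τ (y - t) = _
  rw [rlKernel_mul_rlKernel_sub, MeasureTheory.integral_indicator measurableSet_Ioo]
  rcases le_or_gt y 0 with hy | hy
  · simp [Ioo_eq_empty (not_lt.2 hy), rlKernel_of_nonpos _ hy]
  · rw [MeasureTheory.integral_const_mul, ← integral_Ioc_eq_integral_Ioo,
      ← intervalIntegral.integral_of_le hy.le, integral_rpow_mul_sub_rpow_s10 hσ hτ hy,
      rlKernel_of_pos _ hy]
    have := (Real.Gamma_pos_of_pos hσ).ne'
    have := (Real.Gamma_pos_of_pos hτ).ne'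
    field_simp

lemma convolutionExistsAt_of_eq_zero_of_le {f g : ℝ → ℝ} {a b : ℝ} (hf : LocallyIntegrable f)
    (hg : Continuous g) (hfa : ∀ t ≤ a, f t = 0) (hgb : ∀ t ≤ b, g t = 0) (x : ℝ) :
    ConvolutionExistsAt f g x (ContinuousLinearMap.mul ℝ ℝ) volume := by
  change Integrable (fun t => f t * g (x - t)) volume
  have h : IntegrableOn (fun t => f t * g (x - t)) (Icc a (x - b)) :=
    (hf.integrableOn_isCompact isCompact_Icc).mul_continuousOn
      (by fun_prop) isCompact_Icc
  refine (integrableOn_iff_integrable_of_support_subset fun t ht => ?_).1 h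
  by_contra hn
  refine ht ?_
  rcases le_or_gt t a with h0 | h0
  · simp [hfa t h0]
  · have : x - b < t := not_le.1 fun h => hn ⟨h0.le, h⟩
    simp [hgb (x - t) (by linarith)]

lemma convolution_eq_zero_of_le {f g : ℝ → ℝ} {a b : ℝ}
    (hfa : ∀ t ≤ a, f t = 0) (hgb : ∀ t ≤ b, g t = 0) {x : ℝ} (hx : x ≤ a + b) :
    (f ⋆[ContinuousLinearMap.mul ℝ ℝ, volume] g) x = 0 := by
  change ∫ t, f t * g (x - t) = 0
  refine integral_eq_zero_of_ae (Filter.Eventually.of_forall fun t => ?_)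
  rcases le_or_gt t a with h0 | h0
  · simp [hfa t h0]
  · simp [hgb (x - t) (by linarith)]

lemma continuous_rlKernel_convolution {σ : ℝ} (hσ : 0 < σ) {w : ℝ → ℝ} (hw : Continuous w)
    (hc : HasCompactSupport w) :
    Continuous (rlKernel σ ⋆[ContinuousLinearMap.mul ℝ ℝ, volume] w) :=
  hc.continuous_convolution_right _ (locallyIntegrable_rlKernel hσ) hw

lemma convolution_mul_comm (f g : ℝ → ℝ) :
    f ⋆[ContinuousLinearMap.mul ℝ ℝ, volume] g = g ⋆[ContinuousLinearMap.mul ℝ ℝ, volume] f := by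
  rw [← convolution_flip]
  congr 1
  ext
  simp

lemma norm_rlKernel {σ : ℝ} (hσ : 0 < σ) : (fun x => ‖rlKernel σ x‖) = rlKernel σ := by
  ext x
  exact Real.norm_of_nonneg (rlKernel_nonneg hσ x)

lemma rlKernel_convolution_assoc {σ τ : ℝ} (hσ : 0 < σ) (hτ : 0 < τ) {w : ℝ → ℝ} {a : ℝ}
    (hw : Continuous w) (hc : HasCompactSupport w) (hwa : ∀ t ≤ a, w t = 0) :
    rlKernel (σ + τ) ⋆[ContinuousLinearMap.mul ℝ ℝ, volume] w =
      rlKernel σ ⋆[ContinuousLinearMap.mul ℝ ℝ, volume]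
        (rlKernel τ ⋆[ContinuousLinearMap.mul ℝ ℝ, volume] w) := by
  rw [← rlKernel_convolution_rlKernel hσ hτ]
  ext x
  refine convolution_assoc _ _ _ _ (fun x y z => mul_assoc x y z)
    (locallyIntegrable_rlKernel hσ).aestronglyMeasurable
    (locallyIntegrable_rlKernel hτ).aestronglyMeasurable hw.aestronglyMeasurable
    (Filter.Eventually.of_forall (convolutionExists_rlKernel hσ hτ))
    (Filter.Eventually.of_forall ?_) ?_
  · rw [norm_rlKernel hτ]
    exact hc.norm.convolutionExists_right _ (locallyIntegrable_rlKernel hτ) hw.norm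
  · rw [norm_rlKernel hσ, norm_rlKernel hτ]
    exact convolutionExistsAt_of_eq_zero_of_le (b := 0 + a) (locallyIntegrable_rlKernel hσ)
      (continuous_rlKernel_convolution hτ hw.norm hc.norm)
      (fun t ht => rlKernel_of_nonpos _ ht) (fun t ht => convolution_eq_zero_of_le
        (fun t ht => rlKernel_of_nonpos _ ht) (b := a) (fun t ht => by simp [hwa t ht]) ht) x

lemma rlKernel_convolution_convolution {σ τ : ℝ} (hσ : 0 < σ) (hτ : 0 < τ) {f g : ℝ → ℝ} {a b : ℝ}
    (hf : Continuous f) (hfc : HasCompactSupport f) (hfa : ∀ t ≤ a, f t = 0)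
    (hg : Continuous g) (hgc : HasCompactSupport g) (hgb : ∀ t ≤ b, g t = 0) :
    (rlKernel σ ⋆[ContinuousLinearMap.mul ℝ ℝ, volume] f) ⋆[ContinuousLinearMap.mul ℝ ℝ, volume]
      (rlKernel τ ⋆[ContinuousLinearMap.mul ℝ ℝ, volume] g) =
    (rlKernel (τ + σ) ⋆[ContinuousLinearMap.mul ℝ ℝ, volume] f)
      ⋆[ContinuousLinearMap.mul ℝ ℝ, volume] g := by
  have hF := continuous_rlKernel_convolution hσ hf hfc
  have hF0 : ∀ t ≤ 0 + a, (rlKernel σ ⋆[ContinuousLinearMap.mul ℝ ℝ, volume] f) t = 0 :=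
    fun t ht => convolution_eq_zero_of_le (fun t ht => rlKernel_of_nonpos _ ht) hfa ht
  rw [rlKernel_convolution_assoc hτ hσ hf hfc hfa, convolution_mul_comm (rlKernel τ)
    (rlKernel σ ⋆[ContinuousLinearMap.mul ℝ ℝ, volume] f)]
  ext x
  symm
  refine convolution_assoc _ _ _ _ (fun x y z => mul_assoc x y z) hF.aestronglyMeasurable
    (locallyIntegrable_rlKernel hτ).aestronglyMeasurable hg.aestronglyMeasurable
    (Filter.Eventually.of_forall fun y => ?_)
    (Filter.Eventually.of_forall ?_) ?_
  · have := convolutionExistsAt_of_eq_zero_of_le (locallyIntegrable_rlKernel hτ) hF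
      (fun t ht => rlKernel_of_nonpos _ ht) hF0 y
    exact this.integrable_swap.congr (Filter.Eventually.of_forall fun t => mul_comm _ _)
  · rw [norm_rlKernel hτ]
    exact hgc.norm.convolutionExists_right _ (locallyIntegrable_rlKernel hτ) hg.norm
  · rw [norm_rlKernel hτ]
    exact convolutionExistsAt_of_eq_zero_of_le (b := 0 + b) hF.norm.locallyIntegrable
      (continuous_rlKernel_convolution hτ hg.norm hgc.norm)
      (fun t ht => by rw [hF0 t ht, norm_zero]) (fun t ht => convolution_eq_zero_of_le
        (fun t ht => rlKernel_of_nonpos _ ht) (b := b) (fun t ht => by simp [hgb t ht]) ht) x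

lemma rlKernel_convolution_eq_integral (σ : ℝ) {w : ℝ → ℝ} (hw : ∀ t ≤ 0, w t = 0) (x : ℝ) :
    (Real.Gamma σ)⁻¹ * ∫ t in (0 : ℝ)..x, (x - t) ^ (σ - 1) * w t =
      (rlKernel σ ⋆[ContinuousLinearMap.mul ℝ ℝ, volume] w) x := by
  rcases le_or_gt x 0 with hx | hx
  · rw [convolution_eq_zero_of_le (a := 0) (b := 0) (fun t ht => rlKernel_of_nonpos _ ht) hw
      (by simpa using hx), intervalIntegral.integral_congr (g := fun _ => 0)]
    · simp
    · intro t ht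
      rw [uIcc_of_ge hx] at ht
      simp [hw t ht.2]
  · rw [convolution_mul_comm]
    change _ = ∫ t, w t * rlKernel σ (x - t)
    rw [intervalIntegral.integral_of_le hx.le, integral_Ioc_eq_integral_Ioo,
      ← MeasureTheory.integral_const_mul, ← MeasureTheory.integral_indicator measurableSet_Ioo]
    congr 1
    ext t
    by_cases ht : t ∈ Ioo 0 x
    · rw [indicator_of_mem ht, rlKernel_of_pos _ (sub_pos.2 ht.2)]
      ring
    · rw [indicator_of_notMem ht]
      rcases le_or_gt t 0 with h0 | h0
      · rw [hw t h0, zero_mul]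
      · rw [rlKernel_of_nonpos σ (sub_nonpos.2 (not_lt.1 fun h => ht ⟨h0, h⟩)), mul_zero]

lemma rlKernel_convolution_neg_eq_integral (σ : ℝ) {w : ℝ → ℝ} (hw : ∀ t, 1 ≤ t → w t = 0)
    (x : ℝ) :
    (Real.Gamma σ)⁻¹ * ∫ t in x..(1 : ℝ), (t - x) ^ (σ - 1) * w t =
      (rlKernel σ ⋆[ContinuousLinearMap.mul ℝ ℝ, volume] fun t => w (-t)) (-x) := by
  have h := rlKernel_convolution_eq_integral σ (w := fun t => w (1 - t))
    (fun t ht => hw _ (by linarith)) (1 - x)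
  have h2 := intervalIntegral.integral_comp_sub_left (a := 0) (b := 1 - x)
    (fun t => (t - x) ^ (σ - 1) * w t) 1
  rw [sub_sub_cancel, sub_zero] at h2
  rw [← h2]
  convert! h using 1
  · congr 2
    ext t
    rw [show 1 - t - x = 1 - x - t by ring]
  · change ∫ t, rlKernel σ t * w (-(-x - t)) = ∫ t, rlKernel σ t * w (1 - (1 - x - t))
    congr 1
    ext t
    congr 2
    ring

lemma eq_zero_of_tsupport_subset_Ioo {w : ℝ → ℝ} (h : tsupport w ⊆ Ioo 0 1) :
    (∀ t ≤ 0, w t = 0) ∧ ∀ t, 1 ≤ t → w t = 0 :=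
  ⟨fun _ ht => image_eq_zero_of_notMem_tsupport fun hm => absurd (h hm).1 (not_lt.2 ht),
    fun _ ht => image_eq_zero_of_notMem_tsupport fun hm => absurd (h hm).2 (not_lt.2 ht)⟩

lemma hasCompactSupport_of_tsupport_subset_Ioo {w : ℝ → ℝ} (h : tsupport w ⊆ Ioo 0 1) :
    HasCompactSupport w :=
  isCompact_Icc.of_isClosed_subset (isClosed_tsupport w) (h.trans Ioo_subset_Icc_self)

lemma hasDerivAt_rlKernel_convolution {σ : ℝ} (hσ : 0 < σ) {w : ℝ → ℝ} (hw : ContDiff ℝ 1 w)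
    (hc : HasCompactSupport w) (x : ℝ) :
    HasDerivAt (rlKernel σ ⋆[ContinuousLinearMap.mul ℝ ℝ, volume] w)
      ((rlKernel σ ⋆[ContinuousLinearMap.mul ℝ ℝ, volume] deriv w) x) x :=
  hc.hasDerivAt_convolution_right _ (locallyIntegrable_rlKernel hσ) hw x

lemma rlLeft_eq_convolution {γ : ℝ} (hγ : γ < 1) {w : ℝ → ℝ} (hw : ContDiff ℝ 1 w)
    (hs : tsupport w ⊆ Ioo 0 1) :
    rlLeft γ w = rlKernel (1 - γ) ⋆[ContinuousLinearMap.mul ℝ ℝ, volume] deriv w := by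
  have h : (fun x => (1 / Real.Gamma (1 - γ)) * ∫ t in (0:ℝ)..x, (x - t) ^ (-γ) * w t) =
      rlKernel (1 - γ) ⋆[ContinuousLinearMap.mul ℝ ℝ, volume] w := by
    ext x
    rw [← rlKernel_convolution_eq_integral _ (eq_zero_of_tsupport_subset_Ioo hs).1,
      one_div, show 1 - γ - 1 = -γ by ring]
  rw [rlLeft, h]
  ext x
  exact (hasDerivAt_rlKernel_convolution (by linarith) hw
    (hasCompactSupport_of_tsupport_subset_Ioo hs) x).deriv

lemma rlRight_eq_convolution {γ : ℝ} (hγ : γ < 1) {w : ℝ → ℝ} (hw : ContDiff ℝ 1 w)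
    (hs : tsupport w ⊆ Ioo 0 1) (x : ℝ) :
    rlRight γ w x = (rlKernel (1 - γ) ⋆[ContinuousLinearMap.mul ℝ ℝ, volume]
      deriv fun t => w (-t)) (-x) := by
  have h : (fun x => -(1 / Real.Gamma (1 - γ)) * ∫ t in x..(1:ℝ), (t - x) ^ (-γ) * w t) =
      fun x => -(rlKernel (1 - γ) ⋆[ContinuousLinearMap.mul ℝ ℝ, volume]
        fun t => w (-t)) (-x) := by
    ext x
    rw [← rlKernel_convolution_neg_eq_integral _ (eq_zero_of_tsupport_subset_Ioo hs).2,
      one_div, show 1 - γ - 1 = -γ by ring, neg_mul]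
  have hc : HasCompactSupport fun t => w (-t) :=
    (hasCompactSupport_of_tsupport_subset_Ioo hs).comp_homeomorph (Homeomorph.neg ℝ)
  have hw' : ContDiff ℝ 1 fun t => w (-t) := hw.comp contDiff_neg
  have hd := hasDerivAt_rlKernel_convolution (σ := 1 - γ) (by linarith) hw' hc (-x)
  rw [rlRight, h, deriv.fun_neg, deriv_comp_neg, neg_neg]
  exact hd.deriv

lemma deriv_deriv_fracIntL {α : ℝ} (hα : α < 2) {w : ℝ → ℝ} (hw : ContDiff ℝ 2 w)
    (hs : tsupport w ⊆ Ioo 0 1) :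
    deriv (deriv (fracIntL α w)) =
      rlKernel (2 - α) ⋆[ContinuousLinearMap.mul ℝ ℝ, volume] deriv (deriv w) := by
  have h : fracIntL α w = rlKernel (2 - α) ⋆[ContinuousLinearMap.mul ℝ ℝ, volume] w := by
    ext x
    rw [← rlKernel_convolution_eq_integral _ (eq_zero_of_tsupport_subset_Ioo hs).1,
      fracIntL, one_div, show 2 - α - 1 = 1 - α by ring]
  have hc := hasCompactSupport_of_tsupport_subset_Ioo hs
  have hw' : ContDiff ℝ 1 (deriv w) := hw.deriv'
  have h1 : deriv (fracIntL α w) =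
      rlKernel (2 - α) ⋆[ContinuousLinearMap.mul ℝ ℝ, volume] deriv w := by
    ext x
    rw [h]
    exact (hasDerivAt_rlKernel_convolution (by linarith) (hw.of_le one_le_two) hc x).deriv
  ext x
  rw [h1]
  exact (hasDerivAt_rlKernel_convolution (by linarith) hw' hc.deriv x).deriv

lemma intervalIntegral_eq_integral_of_eq_zero {f : ℝ → ℝ} (h0 : ∀ x ≤ 0, f x = 0)
    (h1 : ∀ x, 1 ≤ x → f x = 0) : ∫ x in (0 : ℝ)..1, f x = ∫ x, f x := by
  refine intervalIntegral.integral_eq_integral_of_support_subset fun x hx => ?_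
  exact ⟨not_le.1 fun h => hx (h0 x h), (not_le.1 fun h => hx (h1 x h)).le⟩

theorem stmt_10 (α : ℝ) (hα₁ : 1 < α) (hα₂ : α < 2)
    (u v : ℝ → ℝ)
    (hu : ContDiff ℝ (⊤ : ℕ∞) u) (hus : tsupport u ⊆ Set.Ioo 0 1)
    (hv : ContDiff ℝ (⊤ : ℕ∞) v) (hvs : tsupport v ⊆ Set.Ioo 0 1) :
    ∫ x in (0:ℝ)..1, deriv (deriv (fracIntL α u)) x * v x
      = ∫ x in (0:ℝ)..1, rlLeft (α/2) u x * rlRight (α/2) v x := by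
  have hu2 : ContDiff ℝ 2 u := contDiff_infty.1 hu 2
  have hv1 : ContDiff ℝ 1 v := hv.of_le (by exact_mod_cast le_top)
  have hu' : ContDiff ℝ 1 (deriv u) := hu2.deriv'
  have huc := hasCompactSupport_of_tsupport_subset_Ioo hus
  have hvc := hasCompactSupport_of_tsupport_subset_Ioo hvs
  have hus' : tsupport (deriv u) ⊆ Ioo 0 1 := (tsupport_deriv_subset).trans hus
  have hu'0 := (eq_zero_of_tsupport_subset_Ioo hus').1
  have hv0 := eq_zero_of_tsupport_subset_Ioo hvs
  have hv'0 := eq_zero_of_tsupport_subset_Ioo ((tsupport_deriv_subset).trans hvs)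
  have hg : deriv (fun t => v (-t)) = fun t => -deriv v (-t) := by
    ext t
    exact deriv_comp_neg v t
  have hv'cont : Continuous (deriv v) := hv1.continuous_deriv le_rfl
  have hgc : HasCompactSupport (deriv fun t => v (-t)) :=
    HasCompactSupport.deriv (hvc.comp_homeomorph (Homeomorph.neg ℝ))
  have hgcont : Continuous (deriv fun t => v (-t)) := by
    rw [hg]
    fun_prop
  have hg0 : ∀ t ≤ -1, deriv (fun t => v (-t)) t = 0 := by
    intro t ht
    rw [hg]
    simp [hv'0.2 (-t) (by linarith)]
  rw [deriv_deriv_fracIntL hα₂ hu2 hus, rlLeft_eq_convolution (by linarith) (hu2.of_le one_le_two) hus]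
  simp_rw [rlRight_eq_convolution (γ := α / 2) (by linarith) hv1 hvs]
  rw [intervalIntegral_eq_integral_of_eq_zero, intervalIntegral_eq_integral_of_eq_zero]
  · have hσ : 0 < 1 - α / 2 := by linarith
    have key := congrFun (rlKernel_convolution_convolution hσ hσ (hu'.continuous) huc.deriv hu'0
      hgcont hgc hg0) 0
    rw [show 1 - α / 2 + (1 - α / 2) = 2 - α by ring] at key
    have key' : ∫ t, (rlKernel (1 - α / 2) ⋆[ContinuousLinearMap.mul ℝ ℝ, volume] deriv u) t *
        (rlKernel (1 - α / 2) ⋆[ContinuousLinearMap.mul ℝ ℝ, volume] deriv fun t => v (-t)) (0 - t) =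
        ∫ t, (rlKernel (2 - α) ⋆[ContinuousLinearMap.mul ℝ ℝ, volume] deriv u) t *
          deriv (fun t => v (-t)) (0 - t) := key
    simp only [zero_sub] at key'
    rw [key', hg]
    have hF := hasDerivAt_rlKernel_convolution (σ := 2 - α) (by linarith) hu' huc.deriv
    have hFc := continuous_rlKernel_convolution (σ := 2 - α) (by linarith) hu'.continuous huc.deriv
    have hF'c := continuous_rlKernel_convolution (σ := 2 - α) (by linarith)
      (hu'.continuous_deriv le_rfl) huc.deriv.deriv
    have hvd : ∀ x, HasDerivAt v (deriv v x) x :=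
      fun x => (hv1.differentiable one_ne_zero x).hasDerivAt
    have hparts := integral_mul_deriv_eq_deriv_mul_of_integrable (fun x _ => hF x) (fun x _ => hvd x)
      ((hFc.mul hv'cont).integrable_of_hasCompactSupport hvc.deriv.mul_left)
      ((hF'c.mul hv1.continuous).integrable_of_hasCompactSupport hvc.mul_left)
      ((hFc.mul hv1.continuous).integrable_of_hasCompactSupport hvc.mul_left)
    simp only [neg_neg, mul_neg, MeasureTheory.integral_neg]
    rw [hparts, neg_neg]
  · exact fun x hx => by
      rw [convolution_eq_zero_of_le (a := 0) (b := 0) (fun t ht => rlKernel_of_nonpos _ ht) hu'0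
        (by linarith), zero_mul]
  · exact fun x hx => by
      rw [convolution_eq_zero_of_le (a := 0) (b := -1) (x := -x)
        (fun t ht => rlKernel_of_nonpos _ ht) hg0 (by linarith), mul_zero]
  · exact fun x hx => by rw [hv0.1 x hx, mul_zero]
  · exact fun x hx => by rw [hv0.2 x hx, mul_zero]
end

section
/- Let 1 < α < 2. Let f ∈ C¹([0,1]) with f(0) = f(1) = 0 and f′(0) = 0, and suppose the left Riemann–Liouville derivative ₀D_x^α f exists and lies in L²(0,1). Let g : [0,1] → ℝ be smooth with compact support in (0,1). Then | ∫₀¹ (₀D_x^{α/2} f)(x) · (ₓD₁^{α/2} g)(x) dx | ≤ ‖₀D_x^α f‖_{L²(0,1)} · ‖g‖_{L²(0,1)}. -/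
open MeasureTheory Set intervalIntegral

/-- The power kernel `r ↦ r ^ (b - 1)` truncated to `(0,1)`. -/
noncomputable def powKernel (b : ℝ) : ℝ → ℝ :=
  (Ioo (0:ℝ) 1).indicator fun r => r ^ (b - 1)

lemma powKernel_of_mem {b r : ℝ} (hr : r ∈ Ioo (0:ℝ) 1) : powKernel b r = r ^ (b - 1) :=
  indicator_of_mem hr _

lemma powKernel_of_notMem {b r : ℝ} (hr : r ∉ Ioo (0:ℝ) 1) : powKernel b r = 0 :=
  indicator_of_notMem hr _

lemma integrable_powKernel {b : ℝ} (hb : 0 < b) : Integrable (powKernel b) := by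
  rw [powKernel, integrable_indicator_iff measurableSet_Ioo,
    ← intervalIntegrable_iff_integrableOn_Ioo_of_le zero_le_one]
  exact intervalIntegrable_rpow' (by linarith)

lemma integrable_powKernel_mul {b : ℝ} (hb : 0 < b) {w : ℝ → ℝ} (hw : Continuous w) :
    Integrable fun r => powKernel b r * w r := by
  obtain ⟨C, hC⟩ := isCompact_Icc.exists_bound_of_continuousOn (hw.continuousOn (s := Icc 0 1))
  refine ((integrable_powKernel hb).norm.mul_const C).mono'
    ((integrable_powKernel hb).aestronglyMeasurable.mul hw.aestronglyMeasurable) ?_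
  refine Filter.Eventually.of_forall fun r => ?_
  rw [norm_mul]
  by_cases hr : r ∈ Ioo (0:ℝ) 1
  · exact mul_le_mul_of_nonneg_left (hC r (Ioo_subset_Icc_self hr)) (norm_nonneg _)
  · simp [powKernel_of_notMem hr]

lemma hasDerivAt_integral_powKernel_mul {b : ℝ} (hb : 0 < b) {u u' : ℝ → ℝ}
    (hu : ∀ x, HasDerivAt u (u' x) x) (hu' : Continuous u') (x : ℝ) :
    HasDerivAt (fun y => ∫ r, powKernel b r * u (y - r)) (∫ r, powKernel b r * u' (x - r)) x := by
  have huc : Continuous u := continuous_iff_continuousAt.2 fun y => (hu y).continuousAt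
  obtain ⟨C, hC⟩ := isCompact_Icc.exists_bound_of_continuousOn
    (hu'.continuousOn (s := Icc (x - 2) (x + 1)))
  refine (_root_.hasDerivAt_integral_of_dominated_loc_of_deriv_le (μ := volume)
    (F := fun y r => powKernel b r * u (y - r)) (F' := fun y r => powKernel b r * u' (y - r))
    (bound := fun r => ‖powKernel b r‖ * C) (Metric.ball_mem_nhds x one_pos)
    (Filter.Eventually.of_forall fun y => ?_) ?_ ?_ ?_ ?_ ?_).2
  · exact (integrable_powKernel_mul hb (by fun_prop)).aestronglyMeasurable
  · exact integrable_powKernel_mul hb (by fun_prop)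
  · exact (integrable_powKernel_mul hb (by fun_prop)).aestronglyMeasurable
  · refine Filter.Eventually.of_forall fun r y hy => ?_
    rw [norm_mul]
    by_cases hr : r ∈ Ioo (0:ℝ) 1
    · rw [Metric.mem_ball, Real.dist_eq, abs_lt] at hy
      exact mul_le_mul_of_nonneg_left
        (hC _ ⟨by linarith [hr.2], by linarith [hr.1]⟩) (norm_nonneg _)
    · simp [powKernel_of_notMem hr]
  · exact (integrable_powKernel hb).norm.mul_const C
  · refine Filter.Eventually.of_forall fun r y _ => ?_
    exact ((hu (y - r)).comp_sub_const y r).const_mul _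

lemma integral_sub_rpow_mul_eq {b x : ℝ} {h u : ℝ → ℝ} (hx : x ∈ Ioo (0:ℝ) 1)
    (hu : ∀ y < 0, u y = 0) (hhu : ∀ y ∈ Icc (0:ℝ) 1, h y = u y) :
    ∫ t in (0:ℝ)..x, (x - t) ^ (b - 1) * h t = ∫ r, powKernel b r * u (x - r) := by
  have h1 : ∫ t in (0:ℝ)..x, (x - t) ^ (b - 1) * h t
      = ∫ t in (0:ℝ)..x, (x - t) ^ (b - 1) * u (x - (x - t)) := by
    refine integral_congr fun t ht => ?_
    rw [uIcc_of_le hx.1.le] at ht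
    simp [hhu t ⟨ht.1, ht.2.trans hx.2.le⟩]
  rw [h1, integral_comp_sub_left (fun r => r ^ (b - 1) * u (x - r)) x, sub_self, sub_zero,
    integral_of_le hx.1.le, ← MeasureTheory.integral_indicator measurableSet_Ioc]
  refine integral_congr_ae ?_
  filter_upwards [compl_mem_ae_iff.2 (measure_singleton (μ := volume) x)] with r hr
  by_cases h0 : r ∈ Ioc 0 x
  · rw [indicator_of_mem h0, powKernel_of_mem ⟨h0.1, h0.2.trans_lt hx.2⟩]
  · rw [indicator_of_notMem h0]
    by_cases h2 : r ∈ Ioo (0:ℝ) 1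
    · rw [hu (x - r), mul_zero]
      have : x < r := by
        by_contra! hlt
        exact h0 ⟨h2.1, hlt⟩
      linarith
    · rw [powKernel_of_notMem h2, zero_mul]

lemma hasDerivAt_integral_sub_rpow_mul {b : ℝ} (hb : 0 < b) {h u u' : ℝ → ℝ}
    (hu : ∀ x, HasDerivAt u (u' x) x) (hu' : Continuous u') (hu0 : ∀ y < 0, u y = 0)
    (hhu : ∀ y ∈ Icc (0:ℝ) 1, h y = u y) {x : ℝ} (hx : x ∈ Ioo (0:ℝ) 1) :
    HasDerivAt (fun x => ∫ t in (0:ℝ)..x, (x - t) ^ (b - 1) * h t)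
      (∫ r, powKernel b r * u' (x - r)) x := by
  refine (hasDerivAt_integral_powKernel_mul hb hu hu' x).congr_of_eventuallyEq ?_
  filter_upwards [isOpen_Ioo.mem_nhds hx] with y hy
  exact integral_sub_rpow_mul_eq hy hu0 hhu

lemma integral_powKernel_mul_powKernel {b a : ℝ} (hb : 0 < b) (ha : a ∈ Ioo (0:ℝ) 1) :
    ∫ s, powKernel b s * powKernel b (a - s)
      = Real.Gamma b ^ 2 / Real.Gamma (2 * b) * powKernel (2 * b) a := by
  have h1 : ∫ s, powKernel b s * powKernel b (a - s)
      = ∫ s in (0:ℝ)..a, s ^ (b - 1) * (a - s) ^ (b - 1) := by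
    rw [integral_of_le ha.1.le, integral_Ioc_eq_integral_Ioo,
      ← MeasureTheory.integral_indicator measurableSet_Ioo]
    refine MeasureTheory.integral_congr_ae (Filter.Eventually.of_forall fun s => ?_)
    dsimp only
    by_cases hs : s ∈ Ioo 0 a
    · rw [indicator_of_mem hs, powKernel_of_mem ⟨hs.1, hs.2.trans ha.2⟩,
        powKernel_of_mem ⟨by linarith [hs.2], by linarith [hs.1, ha.2]⟩]
    · rw [indicator_of_notMem hs]
      by_cases h0 : 0 < s
      · rw [powKernel_of_notMem (r := a - s), mul_zero]
        exact fun h => hs ⟨h0, by linarith [h.1]⟩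
      · rw [powKernel_of_notMem (r := s) fun h => h0 h.1, zero_mul]
  have h2 : ((∫ s in (0:ℝ)..a, s ^ (b - 1) * (a - s) ^ (b - 1) : ℝ) : ℂ)
      = ((a ^ (2 * b - 1) * (Real.Gamma b ^ 2 / Real.Gamma (2 * b)) : ℝ) : ℂ) := by
    have h3 := Complex.betaIntegral_scaled (b : ℂ) (b : ℂ) ha.1
    rw [Complex.betaIntegral_eq_Gamma_mul_div _ _ (by simpa) (by simpa)] at h3
    rw [← intervalIntegral.integral_ofReal]
    have h4 : ∫ s in (0:ℝ)..a, ((s ^ (b - 1) * (a - s) ^ (b - 1) : ℝ) : ℂ)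
        = ∫ s in (0:ℝ)..a, (s : ℂ) ^ ((b : ℂ) - 1) * ((a : ℂ) - s) ^ ((b : ℂ) - 1) := by
      refine integral_congr fun s hs => ?_
      rw [uIcc_of_le ha.1.le] at hs
      rw [Complex.ofReal_mul, Complex.ofReal_cpow hs.1, Complex.ofReal_cpow (by linarith [hs.2])]
      push_cast
      rfl
    rw [h4, h3, Complex.ofReal_mul, Complex.ofReal_cpow ha.1.le]
    push_cast [← Complex.Gamma_ofReal]
    rw [← two_mul, sq]
  rw [h1, Complex.ofReal_injective h2, powKernel_of_mem ha, mul_comm]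

/-- The semigroup property of fractional integration. -/
lemma ae_powKernel_conv_conv {b : ℝ} (hb : 0 < b) {φ : ℝ → ℝ} (hφ : Integrable φ)
    (hφ0 : ∀ y < 0, φ y = 0) : ∀ᵐ x, x ∈ Ioo (0:ℝ) 1 →
      ∫ r, powKernel b r * ∫ s, powKernel b s * φ (x - r - s)
        = Real.Gamma b ^ 2 / Real.Gamma (2 * b) * ∫ r, powKernel (2 * b) r * φ (x - r) := by
  have hk := integrable_powKernel hb
  have hkn := hk.norm
  have hφn := hφ.norm
  filter_upwards [hkn.ae_convolution_exists (ContinuousLinearMap.mul ℝ ℝ)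
    (hkn.integrable_convolution (ContinuousLinearMap.mul ℝ ℝ) hφn)] with x hx hx1
  have := convolution_assoc (ContinuousLinearMap.mul ℝ ℝ) (ContinuousLinearMap.mul ℝ ℝ)
    (ContinuousLinearMap.mul ℝ ℝ) (ContinuousLinearMap.mul ℝ ℝ)
    (fun x y z => by simp [mul_assoc])
    hk.aestronglyMeasurable hk.aestronglyMeasurable hφ.aestronglyMeasurable
    (hk.ae_convolution_exists _ hk) (hkn.ae_convolution_exists _ hφn) hx
  simp only [convolution_def, ContinuousLinearMap.mul_apply'] at this
  rw [← this, ← MeasureTheory.integral_const_mul]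
  refine integral_congr_ae ?_
  filter_upwards [compl_mem_ae_iff.2 (measure_singleton (μ := volume) x)] with r hr
  by_cases h0 : x - r < 0
  · simp [hφ0 _ h0]
  rcases le_or_gt r 0 with h1 | h1
  · rw [powKernel_of_notMem (r := r) fun h => h1.not_gt h.1]
    have : ∀ s, powKernel b s * powKernel b (r - s) = 0 := fun s => by
      by_cases hs : 0 < s
      · rw [powKernel_of_notMem (r := r - s) fun h => by linarith [h.1], mul_zero]
      · rw [powKernel_of_notMem (r := s) fun h => hs h.1, zero_mul]
    simp [this]
  · rw [integral_powKernel_mul_powKernel hb ⟨h1, by linarith [hx1.2]⟩, mul_assoc]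

/-- Left and right fractional integration are adjoint to each other. -/
lemma integral_conv_powKernel_mul {b : ℝ} (hb : 0 < b) {U ψ : ℝ → ℝ} (hU : Integrable U)
    (hψ : Continuous ψ) (hψs : HasCompactSupport ψ) :
    ∫ x, U x * ∫ r, powKernel b r * ψ (x + r) = ∫ y, ψ y * ∫ r, powKernel b r * U (y - r) := by
  have hk := integrable_powKernel hb
  obtain ⟨C, hC⟩ := hψs.exists_bound_of_continuous hψ
  have hi : Integrable (Function.uncurry fun y x => ψ y * (U x * powKernel b (y - x)))
      (volume.prod volume) :=
    (hU.convolution_integrand (ContinuousLinearMap.mul ℝ ℝ) hk).bdd_mul (c := C)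
      (f := fun p : ℝ × ℝ => ψ p.1) (by fun_prop) (Filter.Eventually.of_forall fun p => hC p.1)
  calc ∫ x, U x * ∫ r, powKernel b r * ψ (x + r)
      = ∫ x, ∫ y, ψ y * (U x * powKernel b (y - x)) := by
        refine integral_congr_ae (Filter.Eventually.of_forall fun x => ?_)
        dsimp only
        rw [← integral_sub_right_eq_self (fun r => powKernel b r * ψ (x + r)) x,
          ← MeasureTheory.integral_const_mul]
        refine integral_congr_ae (Filter.Eventually.of_forall fun y => ?_)
        simp only [add_sub_cancel]
        ring
    _ = ∫ y, ∫ x, ψ y * (U x * powKernel b (y - x)) := (integral_integral_swap hi).symm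
    _ = ∫ y, ψ y * ∫ r, powKernel b r * U (y - r) := by
        refine integral_congr_ae (Filter.Eventually.of_forall fun y => ?_)
        dsimp only
        rw [MeasureTheory.integral_const_mul,
          ← integral_sub_left_eq_self (fun r => powKernel b r * U (y - r)) volume y]
        simp only [sub_sub_cancel, mul_comm]

lemma abs_integral_mul_le_sqrt_mul_sqrt {p q : ℝ → ℝ} (hp : Measurable p)
    (hp2 : IntervalIntegrable (fun x => p x ^ 2) volume 0 1) (hq : Continuous q) :
    |∫ x in (0:ℝ)..1, p x * q x|
      ≤ Real.sqrt (∫ x in (0:ℝ)..1, p x ^ 2) * Real.sqrt (∫ x in (0:ℝ)..1, q x ^ 2) := by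
  have hpL : MemLp p (ENNReal.ofReal 2) (volume.restrict (Ioc (0:ℝ) 1)) := by
    rw [show ENNReal.ofReal 2 = 2 by norm_num]
    exact (memLp_two_iff_integrable_sq hp.aestronglyMeasurable).2 (by
      exact (intervalIntegrable_iff_integrableOn_Ioc_of_le zero_le_one).1 hp2)
  have hqL : MemLp q (ENNReal.ofReal 2) (volume.restrict (Ioc (0:ℝ) 1)) := by
    rw [show ENNReal.ofReal 2 = 2 by norm_num]
    exact (memLp_two_iff_integrable_sq hq.aestronglyMeasurable).2
      ((hq.pow 2).intervalIntegrable 0 1).1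
  have h := integral_mul_norm_le_Lp_mul_Lq Real.HolderConjugate.two_two hpL hqL
  simp only [integral_of_le zero_le_one]
  calc |∫ x in Ioc (0:ℝ) 1, p x * q x| ≤ ∫ x in Ioc (0:ℝ) 1, ‖p x‖ * ‖q x‖ := by
        simpa [← norm_mul] using
          MeasureTheory.norm_integral_le_integral_norm (μ := volume.restrict (Ioc (0:ℝ) 1))
            fun x => p x * q x
    _ ≤ _ := h
    _ = _ := by simp [Real.sqrt_eq_rpow]

lemma intervalIntegrable_deriv_of_sq {F : ℝ → ℝ}
    (hF : IntervalIntegrable (fun x => deriv F x ^ 2) volume 0 1) :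
    IntervalIntegrable (deriv F) volume 0 1 := by
  rw [intervalIntegrable_iff_integrableOn_Ioc_of_le zero_le_one] at hF ⊢
  exact ((memLp_two_iff_integrable_sq (measurable_deriv F).aestronglyMeasurable).2 hF).integrable
    (by norm_num)

lemma integral_deriv_mul_eq_neg {F g : ℝ → ℝ} (hF : ∀ x ∈ Ioo (0:ℝ) 1, DifferentiableAt ℝ F x)
    (hF' : IntervalIntegrable (deriv F) volume 0 1) (hg : ContDiff ℝ 1 g)
    (hgs : tsupport g ⊆ Ioo 0 1) :
    ∫ x in (0:ℝ)..1, deriv F x * g x = -∫ x in (0:ℝ)..1, deriv g x * F x := by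
  have hzero : ∀ x ∉ Ioo (0:ℝ) 1, g =ᶠ[nhds x] 0 := fun x hx =>
    notMem_tsupport_iff_eventuallyEq.1 fun h => hx (hgs h)
  have hg' : Continuous (deriv g) := hg.continuous_deriv le_rfl
  have hc : Continuous fun x => deriv g x * F x := by
    refine continuous_iff_continuousAt.2 fun x => ?_
    by_cases hx : x ∈ Ioo (0:ℝ) 1
    · exact hg'.continuousAt.mul (hF x hx).continuousAt
    · refine (continuousAt_const (y := (0:ℝ))).congr ?_
      filter_upwards [(hzero x hx).deriv] with y hy
      simp [hy, Pi.zero_def]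
  have hd : ∀ x, HasDerivAt (fun x => F x * g x) (deriv F x * g x + deriv g x * F x) x := by
    intro x
    by_cases hx : x ∈ Ioo (0:ℝ) 1
    · rw [mul_comm (deriv g x)]
      exact (hF x hx).hasDerivAt.mul (hg.differentiable one_ne_zero x).hasDerivAt
    · have h0 := (hzero x hx).deriv.eq_of_nhds
      have h1 := (hzero x hx).eq_of_nhds
      simp only [h0, h1, Pi.zero_def, deriv_const, mul_zero, zero_mul, add_zero]
      refine (hasDerivAt_const x (0:ℝ)).congr_of_eventuallyEq ?_
      filter_upwards [hzero x hx] with y hy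
      simp [hy]
  have hi : IntervalIntegrable (fun x => deriv F x * g x) volume 0 1 :=
    hF'.mul_continuousOn hg.continuous.continuousOn
  have hsum := integral_eq_sub_of_hasDerivAt (fun x _ => hd x)
    (hi.add (hc.intervalIntegrable 0 1))
  have h1 := (hzero 1 (by simp)).eq_of_nhds
  have h0 := (hzero 0 (by simp)).eq_of_nhds
  rw [intervalIntegral.integral_add hi (hc.intervalIntegrable 0 1), h1, h0] at hsum
  simp only [Pi.zero_apply, mul_zero, sub_zero] at hsum
  linarith

lemma rlLeft_eq {γ : ℝ} (hγ : γ < 1) {h u u' : ℝ → ℝ}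
    (hu : ∀ x, HasDerivAt u (u' x) x) (hu' : Continuous u') (hu0 : ∀ y < 0, u y = 0)
    (hhu : ∀ y ∈ Icc (0:ℝ) 1, h y = u y) {x : ℝ} (hx : x ∈ Ioo (0:ℝ) 1) :
    rlLeft γ h x = 1 / Real.Gamma (1 - γ) * ∫ r, powKernel (1 - γ) r * u' (x - r) := by
  have := (hasDerivAt_integral_sub_rpow_mul (sub_pos.2 hγ) hu hu' hu0 hhu hx).const_mul
    (1 / Real.Gamma (1 - γ))
  rw [show 1 - γ - 1 = -γ by ring] at this
  exact this.deriv

lemma deriv_fracIntL_eq {α : ℝ} (hα : α < 2) {h u u' : ℝ → ℝ}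
    (hu : ∀ x, HasDerivAt u (u' x) x) (hu' : Continuous u') (hu0 : ∀ y < 0, u y = 0)
    (hhu : ∀ y ∈ Icc (0:ℝ) 1, h y = u y) {x : ℝ} (hx : x ∈ Ioo (0:ℝ) 1) :
    deriv (fracIntL α h) x = 1 / Real.Gamma (2 - α) * ∫ r, powKernel (2 - α) r * u' (x - r) := by
  have := (hasDerivAt_integral_sub_rpow_mul (sub_pos.2 hα) hu hu' hu0 hhu hx).const_mul
    (1 / Real.Gamma (2 - α))
  rw [show 2 - α - 1 = 1 - α by ring] at this
  exact this.deriv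

lemma rlRight_eq_rlLeft_reflect (γ : ℝ) (g : ℝ → ℝ) (x : ℝ) :
    rlRight γ g x = rlLeft γ (fun s => g (1 - s)) (1 - x) := by
  have : (fun x => -(1 / Real.Gamma (1 - γ)) * ∫ t in x..(1:ℝ), (t - x) ^ (-γ) * g t)
      = fun x => -((fun y => (1 / Real.Gamma (1 - γ)) *
          ∫ s in (0:ℝ)..y, (y - s) ^ (-γ) * g (1 - s)) (1 - x)) := by
    funext x
    have h := integral_comp_sub_left (a := 0) (b := 1 - x) (fun t => (t - x) ^ (-γ) * g t) 1
    simp only [sub_sub_cancel, sub_zero] at h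
    rw [← h, neg_mul]
    simp only [sub_right_comm]
  rw [rlRight, this, deriv.fun_neg, deriv_comp_const_sub
    (fun y => 1 / Real.Gamma (1 - γ) * ∫ s in (0:ℝ)..y, (y - s) ^ (-γ) * g (1 - s)),
    neg_neg, rlLeft]

lemma rlRight_eq {γ : ℝ} (hγ : γ < 1) {g : ℝ → ℝ} (hg : ContDiff ℝ 1 g)
    (hgs : tsupport g ⊆ Ioo 0 1) {x : ℝ} (hx : x ∈ Ioo (0:ℝ) 1) :
    rlRight γ g x
      = -(1 / Real.Gamma (1 - γ) * ∫ r, powKernel (1 - γ) r * deriv g (x + r)) := by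
  have hg' : Continuous (deriv g) := hg.continuous_deriv le_rfl
  rw [rlRight_eq_rlLeft_reflect, rlLeft_eq (u := fun s => g (1 - s))
    (u' := fun s => -deriv g (1 - s)) hγ
    (fun y => (hg.differentiable one_ne_zero (1 - y)).hasDerivAt.comp_const_sub 1 y)
    (by fun_prop) (fun y hy => ?_) (fun y _ => rfl) ⟨by linarith [hx.2], by linarith [hx.1]⟩]
  · simp only [mul_neg, MeasureTheory.integral_neg]
    congr! 6
    ring
  · exact image_eq_zero_of_notMem_tsupport fun h => by linarith [(hgs h).2]

/-- A `C¹` function on `[0,1]` vanishing to first order at `0` extends to a `C¹` function on `ℝ`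
vanishing on `(-∞,0)`. -/
lemma exists_contDiff_extension {f f' : ℝ → ℝ}
    (hf' : ∀ x ∈ Icc (0:ℝ) 1, HasDerivWithinAt f (f' x) (Icc 0 1) x)
    (hf'c : ContinuousOn f' (Icc 0 1)) (hf0 : f 0 = 0) (hf'0 : f' 0 = 0) :
    ∃ u u' : ℝ → ℝ, (∀ x, HasDerivAt u (u' x) x) ∧ Continuous u' ∧ (∀ y < 0, u y = 0) ∧
      (∀ y < 0, u' y = 0) ∧ ∀ y ∈ Icc (0:ℝ) 1, f y = u y := by
  set w : ℝ → ℝ := IccExtend (zero_le_one (α := ℝ)) ((Icc (0:ℝ) 1).domRestrict f') with hw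
  have hwc : Continuous w := (continuousOn_iff_continuous_domRestrict.1 hf'c).Icc_extend'
  have hw0 : ∀ y ≤ 0, w y = 0 := fun y hy => by
    rw [hw, IccExtend_of_le_left _ _ hy, domRestrict_apply, hf'0]
  refine ⟨fun x => ∫ t in (0:ℝ)..x, w t, w, fun x => hwc.integral_hasStrictDerivAt 0 x
    |>.hasDerivAt, hwc, fun y hy => ?_, fun y hy => hw0 y hy.le, fun y hy => ?_⟩
  · dsimp only
    rw [integral_symm, neg_eq_zero]
    refine (integral_congr fun t ht => ?_).trans integral_zero
    rw [uIcc_of_le hy.le] at ht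
    exact hw0 t ht.2
  · dsimp only
    rw [integral_eq_sub_of_hasDerivAt_of_le (f := f) hy.1
      (fun t ht => ((hf' t ⟨ht.1, ht.2.trans hy.2⟩).continuousWithinAt).mono
        (Icc_subset_Icc_right hy.2)) (fun t ht => ?_) (hwc.intervalIntegrable _ _), hf0, sub_zero]
    have ht1 : t ∈ Ioo (0:ℝ) 1 := ⟨ht.1, ht.2.trans_le hy.2⟩
    rw [hw, IccExtend_of_mem _ _ (Ioo_subset_Icc_self ht1)]
    exact (hf' t (Ioo_subset_Icc_self ht1)).hasDerivAt (Icc_mem_nhds ht1.1 ht1.2)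

theorem stmt_11 (α : ℝ) (hα₁ : 1 < α) (hα₂ : α < 2)
    -- `f ∈ C¹([0,1])` with derivative `f'`, `f(0) = f(1) = 0`, `f'(0) = 0`:
    (f f' : ℝ → ℝ)
    (hf' : ∀ x ∈ Set.Icc (0:ℝ) 1, HasDerivWithinAt f (f' x) (Set.Icc 0 1) x)
    (hf'c : ContinuousOn f' (Set.Icc 0 1))
    (hf0 : f 0 = 0) (hf1 : f 1 = 0) (hf'0 : f' 0 = 0)
    -- `₀D_x^α f` exists on `(0,1)` ...
    (hex : ∀ x ∈ Set.Ioo (0:ℝ) 1,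
      DifferentiableAt ℝ (fracIntL α f) x ∧
      DifferentiableAt ℝ (deriv (fracIntL α f)) x)
    -- ... and lies in `L²(0,1)`:
    (hL2 : IntervalIntegrable (fun x => (deriv (deriv (fracIntL α f)) x) ^ 2)
      volume 0 1)
    -- `g` smooth with compact support in `(0,1)`:
    (g : ℝ → ℝ) (hg : ContDiff ℝ (⊤ : ℕ∞) g) (hgs : tsupport g ⊆ Set.Ioo 0 1) :
    |∫ x in (0:ℝ)..1, rlLeft (α/2) f x * rlRight (α/2) g x|
      ≤ Real.sqrt (∫ x in (0:ℝ)..1, (deriv (deriv (fracIntL α f)) x) ^ 2) *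
        Real.sqrt (∫ x in (0:ℝ)..1, (g x) ^ 2) := by
  obtain ⟨u, u', hu, hu'c, hu0, hu'0, hfu⟩ := exists_contDiff_extension hf' hf'c hf0 hf'0
  have hγ : α / 2 < 1 := by linarith
  have hg1 : ContDiff ℝ 1 g := hg.of_le (by exact_mod_cast le_top)
  have hg' : Continuous (deriv g) := hg1.continuous_deriv le_rfl
  have hgs' : HasCompactSupport g :=
    isCompact_Icc.of_isClosed_subset (isClosed_tsupport g) (hgs.trans Ioo_subset_Icc_self)
  have hψ0 : ∀ y ∉ Ioo (0:ℝ) 1, deriv g y = 0 := fun y hy =>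
    image_eq_zero_of_notMem_tsupport fun h => hy (hgs (tsupport_deriv_subset h))
  set b := 1 - α / 2 with hb_def
  have hb : 0 < b := by linarith
  have h2b : 2 - α = 2 * b := by rw [hb_def]; ring
  set φ : ℝ → ℝ := (Icc (0:ℝ) 1).indicator u' with hφ_def
  have hφ : Integrable φ :=
    (integrable_indicator_iff measurableSet_Icc).2 (hu'c.continuousOn.integrableOn_compact
      isCompact_Icc)
  have hφ0 : ∀ y < 0, φ y = 0 := fun y hy => indicator_of_notMem (fun h => hy.not_ge h.1) _
  have hφu : ∀ c, ∀ x ∈ Ioo (0:ℝ) 1,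
      ∫ r, powKernel c r * u' (x - r) = ∫ r, powKernel c r * φ (x - r) := by
    intro c x hx
    refine integral_congr_ae (Filter.Eventually.of_forall fun r => ?_)
    dsimp only
    by_cases hr : r ∈ Ioo (0:ℝ) 1
    · rcases lt_or_ge (x - r) 0 with h | h
      · rw [hu'0 _ h, hφ0 _ h]
      · rw [hφ_def, indicator_of_mem (show x - r ∈ Icc (0:ℝ) 1 from ⟨h, by linarith [hx.2, hr.1]⟩)]
    · simp [powKernel_of_notMem hr]
  set U : ℝ → ℝ := fun x => ∫ s, powKernel b s * φ (x - s) with hU_def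
  have hU : Integrable U :=
    (integrable_powKernel hb).integrable_convolution (ContinuousLinearMap.mul ℝ ℝ) hφ
  have hU0 : ∀ x ≤ 0, U x = 0 := by
    intro x hx
    refine integral_eq_zero_of_ae (Filter.Eventually.of_forall fun s => ?_)
    by_cases hs : s ∈ Ioo (0:ℝ) 1
    · simp [hφ0 (x - s) (by linarith [hs.1])]
    · simp [powKernel_of_notMem hs]
  have hS0 : ∀ x ≥ 1, ∫ r, powKernel b r * deriv g (x + r) = 0 := by
    intro x hx
    refine integral_eq_zero_of_ae (Filter.Eventually.of_forall fun s => ?_)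
    by_cases hs : s ∈ Ioo (0:ℝ) 1
    · simp [hψ0 (x + s) fun h => by linarith [h.2, hs.1]]
    · simp [powKernel_of_notMem hs]
  have hΓ : Real.Gamma b ≠ 0 := (Real.Gamma_pos_of_pos hb).ne'
  have key : ∫ x in (0:ℝ)..1, rlLeft (α/2) f x * rlRight (α/2) g x
      = ∫ x in (0:ℝ)..1, deriv (deriv (fracIntL α f)) x * g x := by
    have hF : ∀ x ∈ Ioo (0:ℝ) 1, deriv (fracIntL α f) x
        = 1 / Real.Gamma (2 * b) * ∫ r, powKernel (2 * b) r * φ (x - r) := fun x hx => by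
      rw [deriv_fracIntL_eq hα₂ hu hu'c hu0 hfu hx, hφu _ x hx, h2b]
    calc ∫ x in (0:ℝ)..1, rlLeft (α/2) f x * rlRight (α/2) g x
        = ∫ x in (0:ℝ)..1, -(1 / Real.Gamma b) ^ 2 *
            (U x * ∫ r, powKernel b r * deriv g (x + r)) := by
          simp only [integral_of_le zero_le_one, integral_Ioc_eq_integral_Ioo]
          refine setIntegral_congr_fun measurableSet_Ioo fun x hx => ?_
          rw [rlLeft_eq hγ hu hu'c hu0 hfu hx, rlRight_eq hγ hg1 hgs hx, hφu _ x hx]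
          ring
      _ = -(1 / Real.Gamma b) ^ 2 * ∫ x, U x * ∫ r, powKernel b r * deriv g (x + r) := by
          rw [intervalIntegral.integral_const_mul, integral_eq_integral_of_support_subset]
          intro x hx
          by_contra h
          refine hx ?_
          dsimp only
          by_cases h0 : 0 < x
          · rw [hS0 x (by by_contra! h1; exact h ⟨h0, h1.le⟩), mul_zero]
          · rw [hU0 x (not_lt.1 h0), zero_mul]
      _ = -(1 / Real.Gamma b) ^ 2 *
            ∫ y in (0:ℝ)..1, deriv g y * ∫ r, powKernel b r * U (y - r) := by
          rw [integral_conv_powKernel_mul hb hU hg' hgs'.deriv,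
            integral_eq_integral_of_support_subset]
          intro x hx
          by_contra h
          refine hx ?_
          simp [hψ0 x fun h' => h ⟨h'.1, h'.2.le⟩]
      _ = -∫ y in (0:ℝ)..1, deriv g y * deriv (fracIntL α f) y := by
          rw [neg_mul, ← intervalIntegral.integral_const_mul]
          simp only [integral_of_le zero_le_one, integral_Ioc_eq_integral_Ioo]
          congr 1
          refine setIntegral_congr_ae measurableSet_Ioo ?_
          filter_upwards [ae_powKernel_conv_conv hb hφ hφ0] with x hx hx1
          rw [hF x hx1, hx hx1]
          field_simp
      _ = ∫ x in (0:ℝ)..1, deriv (deriv (fracIntL α f)) x * g x :=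
          (integral_deriv_mul_eq_neg (fun x hx => (hex x hx).2)
            (intervalIntegrable_deriv_of_sq hL2) hg1 hgs).symm
  rw [key]
  exact abs_integral_mul_le_sqrt_mul_sqrt (measurable_deriv _) hL2 hg.continuous
end

section
/- Let 1 < α < 2. There exist constants C > 0 and h₀ > 0, depending only on α, such that the following holds: for every finite set X = {x₁, …, x_N} ⊂ (0,1) with fill distance h = sup_{x∈[0,1]} min_{1≤j≤N} |x − x_j| ≤ h₀, and every continuous function u : [0,1] → ℝ with finite Gagliardo seminorm |u|_{H^{α/2}(0,1)} < ∞ and u(x_i) = 0 for all i = 1, …, N, one has ‖u‖_{L²(0,1)} ≤ C · h^{α/2} · |u|_{H^{α/2}(0,1)}. -/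
open MeasureTheory Set intervalIntegral

/-- The fill distance `h = sup_{x ∈ [0,1]} min_{x_j ∈ X} |x - x_j|` of a finite
point set `X` relative to `[0,1]`. -/
noncomputable def fillDist (X : Finset ℝ) : ℝ :=
  ⨆ x : Set.Icc (0:ℝ) 1, ⨅ j : X, |(x : ℝ) - (j : ℝ)|

/-- The integrand of the squared Gagliardo seminorm of order `α / 2` in dimension one. -/
noncomputable def gagliardoIntegrand (α : ℝ) (u : ℝ → ℝ) (p : ℝ × ℝ) : ℝ :=
  (u p.1 - u p.2) ^ 2 / |p.1 - p.2| ^ (1 + α)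

theorem gagliardoIntegrand_nonneg (α : ℝ) (u : ℝ → ℝ) (p : ℝ × ℝ) :
    0 ≤ gagliardoIntegrand α u p := by
  unfold gagliardoIntegrand; positivity

theorem sq_sub_le_rpow_mul_gagliardoIntegrand {α ℓ : ℝ} (hα : 0 ≤ 1 + α) (u : ℝ → ℝ)
    {p : ℝ × ℝ} (hp : |p.1 - p.2| ≤ ℓ) :
    (u p.1 - u p.2) ^ 2 ≤ ℓ ^ (1 + α) * gagliardoIntegrand α u p := by
  rcases eq_or_ne p.1 p.2 with h | h
  · simp [gagliardoIntegrand, h]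
  · have h0 : 0 < |p.1 - p.2| := abs_pos.2 (sub_ne_zero.2 h)
    have h1 : |p.1 - p.2| ^ (1 + α) ≤ ℓ ^ (1 + α) := Real.rpow_le_rpow h0.le hp hα
    have h2 : 0 < |p.1 - p.2| ^ (1 + α) := Real.rpow_pos_of_pos h0 _
    unfold gagliardoIntegrand
    rw [mul_div_assoc', le_div_iff₀ h2, mul_comm]
    exact mul_le_mul_of_nonneg_right h1 (sq_nonneg _)

theorem sq_le_weighted_sq_add_sq_sub (a b : ℝ) {t : ℝ} (ht : 0 < t) :
    a ^ 2 ≤ (1 + t) * b ^ 2 + (1 + 1 / t) * (a - b) ^ 2 := by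
  have h : (1 + t) * b ^ 2 + (1 + 1 / t) * (a - b) ^ 2 - a ^ 2 = (t * b - (a - b)) ^ 2 / t := by
    field_simp; ring
  have : 0 ≤ (t * b - (a - b)) ^ 2 / t := by positivity
  linarith

theorem le_add_of_forall_sq_le_weighted {A B D : ℝ} (hB : 0 ≤ B) (hD : 0 ≤ D)
    (h : ∀ t > 0, A ^ 2 ≤ (1 + t) * B ^ 2 + (1 + 1 / t) * D ^ 2) : A ≤ B + D := by
  refine le_of_forall_pos_le_add fun ε hε => ?_
  have hB' : 0 < B + ε / 2 := by positivity
  have hD' : 0 < D + ε / 2 := by positivity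
  have key : A ^ 2 ≤ (B + D + ε) ^ 2 := by
    calc A ^ 2 ≤ (1 + (D + ε / 2) / (B + ε / 2)) * B ^ 2
          + (1 + 1 / ((D + ε / 2) / (B + ε / 2))) * D ^ 2 := h _ (by positivity)
      _ ≤ (1 + (D + ε / 2) / (B + ε / 2)) * (B + ε / 2) ^ 2
          + (1 + 1 / ((D + ε / 2) / (B + ε / 2))) * (D + ε / 2) ^ 2 := by
        gcongr <;> linarith
      _ = (B + D + ε) ^ 2 := by field_simp; ring
  exact (abs_le_of_sq_le_sq' key (by positivity)).2

/-- The root mean square of `u` over `[a, b]`. -/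
noncomputable def rootMeanSquare (u : ℝ → ℝ) (a b : ℝ) : ℝ :=
  Real.sqrt ((∫ x in Icc a b, u x ^ 2) / (b - a))

theorem sq_rootMeanSquare (u : ℝ → ℝ) {a b : ℝ} (hab : a < b) :
    rootMeanSquare u a b ^ 2 = (∫ x in Icc a b, u x ^ 2) / (b - a) := by
  rw [rootMeanSquare, Real.sq_sqrt]
  exact div_nonneg (integral_nonneg fun x => sq_nonneg _) (by linarith)

theorem setIntegral_sq_fst_prod (u : ℝ → ℝ) {a b c d : ℝ} (hcd : c ≤ d) :
    ∫ p in Icc a b ×ˢ Icc c d, u p.1 ^ 2 = (d - c) * ∫ x in Icc a b, u x ^ 2 := by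
  have h := setIntegral_prod_mul (μ := (volume : Measure ℝ)) (ν := (volume : Measure ℝ))
    (fun x => u x ^ 2) (fun _ => (1 : ℝ)) (Icc a b) (Icc c d)
  simp only [mul_one] at h
  rw [Measure.volume_eq_prod, h]
  simp [hcd, mul_comm]

theorem setIntegral_sq_snd_prod (u : ℝ → ℝ) {a b c d : ℝ} (hab : a ≤ b) :
    ∫ p in Icc a b ×ˢ Icc c d, u p.2 ^ 2 = (b - a) * ∫ x in Icc c d, u x ^ 2 := by
  have h := setIntegral_prod_mul (μ := (volume : Measure ℝ)) (ν := (volume : Measure ℝ))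
    (fun _ => (1 : ℝ)) (fun x => u x ^ 2) (Icc a b) (Icc c d)
  simp only [one_mul] at h
  rw [Measure.volume_eq_prod, h]
  simp [hab]

theorem rootMeanSquare_le_add {α : ℝ} (hα : 0 ≤ 1 + α) {u : ℝ → ℝ} {a b c d : ℝ} (hac : a ≤ c)
    (hcd : c < d) (hdb : d ≤ b) (hu : ContinuousOn u (Icc a b))
    (hint : IntegrableOn (gagliardoIntegrand α u) (Icc a b ×ˢ Icc a b)) :
    rootMeanSquare u a b ≤ rootMeanSquare u c d +
      Real.sqrt ((b - a) ^ α / (d - c) * ∫ p in Icc a b ×ˢ Icc a b, gagliardoIntegrand α u p) := by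
  have hab : a < b := by linarith
  have hba0 : 0 < b - a := by linarith
  have hdc0 : 0 < d - c := by linarith
  set E := ∫ p in Icc a b ×ˢ Icc a b, gagliardoIntegrand α u p
  have hE0 : 0 ≤ E := integral_nonneg fun p => gagliardoIntegrand_nonneg α u p
  have hsub : Icc c d ⊆ Icc a b := Icc_subset_Icc hac hdb
  have hsub2 : Icc a b ×ˢ Icc c d ⊆ Icc a b ×ˢ Icc a b := prod_mono_right hsub
  have hcpt : IsCompact (Icc a b ×ˢ Icc c d) := isCompact_Icc.prod isCompact_Icc
  have hmeas : MeasurableSet (Icc a b ×ˢ Icc c d) := measurableSet_Icc.prod measurableSet_Icc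
  have hu1 : ContinuousOn (fun p : ℝ × ℝ => u p.1) (Icc a b ×ˢ Icc c d) :=
    hu.comp continuousOn_fst fun p hp => hp.1
  have hu2 : ContinuousOn (fun p : ℝ × ℝ => u p.2) (Icc a b ×ˢ Icc c d) :=
    hu.comp continuousOn_snd fun p hp => hsub hp.2
  have hi1 : IntegrableOn (fun p : ℝ × ℝ => u p.1 ^ 2) (Icc a b ×ˢ Icc c d) :=
    (hu1.pow 2).integrableOn_compact hcpt
  have hi2 : IntegrableOn (fun p : ℝ × ℝ => u p.2 ^ 2) (Icc a b ×ˢ Icc c d) :=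
    (hu2.pow 2).integrableOn_compact hcpt
  have hi3 : IntegrableOn (fun p : ℝ × ℝ => (u p.1 - u p.2) ^ 2) (Icc a b ×ˢ Icc c d) :=
    ((hu1.sub hu2).pow 2).integrableOn_compact hcpt
  have hdiff : ∫ p in Icc a b ×ˢ Icc c d, (u p.1 - u p.2) ^ 2 ≤ (b - a) ^ (1 + α) * E := by
    calc ∫ p in Icc a b ×ˢ Icc c d, (u p.1 - u p.2) ^ 2
        ≤ ∫ p in Icc a b ×ˢ Icc c d, (b - a) ^ (1 + α) * gagliardoIntegrand α u p := by
          refine setIntegral_mono_on hi3 ((hint.mono_set hsub2).const_mul _) hmeas fun p hp => ?_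
          refine sq_sub_le_rpow_mul_gagliardoIntegrand hα u ?_
          have h1 := hp.1
          have h2 := hsub hp.2
          rw [abs_le]
          constructor <;> linarith [h1.1, h1.2, h2.1, h2.2]
      _ = (b - a) ^ (1 + α) * ∫ p in Icc a b ×ˢ Icc c d, gagliardoIntegrand α u p :=
          MeasureTheory.integral_const_mul _ _
      _ ≤ (b - a) ^ (1 + α) * E := by
          refine mul_le_mul_of_nonneg_left ?_ (by positivity)
          exact setIntegral_mono_set hint
            (Filter.Eventually.of_forall fun p => gagliardoIntegrand_nonneg α u p)
            (Filter.Eventually.of_forall hsub2)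
  refine le_add_of_forall_sq_le_weighted (Real.sqrt_nonneg _) (Real.sqrt_nonneg _) fun t ht => ?_
  rw [sq_rootMeanSquare u hab, sq_rootMeanSquare u hcd, Real.sq_sqrt (by positivity)]
  have hmain : (d - c) * ∫ x in Icc a b, u x ^ 2 ≤
      (1 + t) * ((b - a) * ∫ x in Icc c d, u x ^ 2)
        + (1 + 1 / t) * ((b - a) ^ (1 + α) * E) := by
    calc (d - c) * ∫ x in Icc a b, u x ^ 2
        = ∫ p in Icc a b ×ˢ Icc c d, u p.1 ^ 2 := (setIntegral_sq_fst_prod u hcd.le).symm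
      _ ≤ ∫ p in Icc a b ×ˢ Icc c d,
            ((1 + t) * u p.2 ^ 2 + (1 + 1 / t) * (u p.1 - u p.2) ^ 2) :=
          setIntegral_mono_on hi1
            (Integrable.fun_add (hi2.const_mul (1 + t)) (hi3.const_mul (1 + 1 / t))) hmeas
            fun p _ => sq_le_weighted_sq_add_sq_sub _ _ ht
      _ = (1 + t) * ((b - a) * ∫ x in Icc c d, u x ^ 2)
          + (1 + 1 / t) * ∫ p in Icc a b ×ˢ Icc c d, (u p.1 - u p.2) ^ 2 := by
          rw [MeasureTheory.integral_add (hi2.const_mul _) (hi3.const_mul _),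
            MeasureTheory.integral_const_mul, MeasureTheory.integral_const_mul,
            setIntegral_sq_snd_prod u hab.le]
      _ ≤ _ := by gcongr
  rw [Real.rpow_add hba0, Real.rpow_one] at hmain
  rw [div_le_iff₀ hba0]
  refine le_of_mul_le_mul_left (hmain.trans_eq ?_) hdc0
  field_simp

theorem rootMeanSquare_le_of_abs_le {u : ℝ → ℝ} {a b ε : ℝ} (hab : a < b)
    (hu : ContinuousOn u (Icc a b)) (hε : 0 ≤ ε) (h : ∀ x ∈ Icc a b, |u x| ≤ ε) :
    rootMeanSquare u a b ≤ ε := by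
  have hab0 : 0 < b - a := by linarith
  refine Real.sqrt_le_iff.2 ⟨hε, ?_⟩
  rw [div_le_iff₀ hab0]
  calc ∫ x in Icc a b, u x ^ 2 ≤ ∫ x in Icc a b, ε ^ 2 :=
        setIntegral_mono_on ((hu.pow 2).integrableOn_compact isCompact_Icc)
          (continuousOn_const.integrableOn_compact isCompact_Icc) measurableSet_Icc
          fun x hx => sq_le_sq' (abs_le.1 (h x hx)).1 (abs_le.1 (h x hx)).2
    _ = ε ^ 2 * (b - a) := by simp [hab.le, mul_comm]

/-- The constant in the fractional Poincaré inequality for functions with a zero. -/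
noncomputable def poincareConst (α : ℝ) : ℝ :=
  2 * (1 / (1 - (1 / 2 : ℝ) ^ ((α - 1) / 2))) ^ 2

theorem half_rpow_lt_one {α : ℝ} (hα : 1 < α) : (1 / 2 : ℝ) ^ ((α - 1) / 2) < 1 :=
  Real.rpow_lt_one (by norm_num) (by norm_num) (by linarith)

theorem poincareConst_pos {α : ℝ} (hα : 1 < α) : 0 < poincareConst α := by
  have : 0 < 1 - (1 / 2 : ℝ) ^ ((α - 1) / 2) := sub_pos.2 (half_rpow_lt_one hα)
  unfold poincareConst; positivity

/-- A fractional Poincaré inequality for a continuous function with a zero. It is proved by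
comparing root mean squares over the intervals obtained by successively halving `[a, b]`
towards the zero. -/
theorem setIntegral_sq_le_of_zero {α : ℝ} (hα : 1 < α) {u : ℝ → ℝ} {a b z : ℝ} (hab : a < b)
    (hz : z ∈ Icc a b) (huz : u z = 0) (hu : ContinuousOn u (Icc a b))
    (hint : IntegrableOn (gagliardoIntegrand α u) (Icc a b ×ˢ Icc a b)) :
    ∫ x in Icc a b, u x ^ 2 ≤ poincareConst α * (b - a) ^ α *
      ∫ p in Icc a b ×ˢ Icc a b, gagliardoIntegrand α u p := by
  have hba0 : 0 < b - a := by linarith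
  set E := ∫ p in Icc a b ×ˢ Icc a b, gagliardoIntegrand α u p
  have hE0 : 0 ≤ E := integral_nonneg fun p => gagliardoIntegrand_nonneg α u p
  set r : ℝ := (1 / 2 : ℝ) ^ ((α - 1) / 2) with hr
  have hr0 : 0 < r := by positivity
  have hr1 : r < 1 := half_rpow_lt_one hα
  set D := Real.sqrt (2 * (b - a) ^ (α - 1) * E) with hD
  let left : ℕ → ℝ := fun n => z + (1 / 2 : ℝ) ^ n * (a - z)
  let right : ℕ → ℝ := fun n => z + (1 / 2 : ℝ) ^ n * (b - z)
  have hlen (n : ℕ) : right n - left n = (1 / 2 : ℝ) ^ n * (b - a) := by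
    simp only [left, right]; ring
  have hlt (n : ℕ) : left n < right n := by
    have : 0 < (1 / 2 : ℝ) ^ n * (b - a) := by positivity
    linarith [hlen n]
  have hpow (n : ℕ) : (1 / 2 : ℝ) ^ n ≤ 1 := pow_le_one₀ (by norm_num) (by norm_num)
  have hl (n : ℕ) : left n ≤ left (n + 1) := by
    simp only [left, pow_succ]
    have : (0 : ℝ) ≤ (1 / 2) ^ n * (z - a) := mul_nonneg (by positivity) (by linarith [hz.1])
    linarith
  have hrt (n : ℕ) : right (n + 1) ≤ right n := by
    simp only [right, pow_succ]
    have : (0 : ℝ) ≤ (1 / 2) ^ n * (b - z) := mul_nonneg (by positivity) (by linarith [hz.2])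
    linarith
  have hsub (n : ℕ) : Icc (left n) (right n) ⊆ Icc a b := by
    refine Icc_subset_Icc ?_ ?_
    · simp only [left]; nlinarith [hpow n, hz.1]
    · simp only [right]; nlinarith [hpow n, hz.2]
  have hstep (n : ℕ) : rootMeanSquare u (left n) (right n) ≤
      rootMeanSquare u (left (n + 1)) (right (n + 1)) + D * r ^ n := by
    have hsub2 := prod_mono (hsub n) (hsub n)
    refine (rootMeanSquare_le_add (by linarith) (hl n) (hlt (n + 1)) (hrt n)
      (hu.mono (hsub n)) (hint.mono_set hsub2)).trans ?_
    gcongr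
    have hr2 : D * r ^ n = Real.sqrt (2 * (b - a) ^ (α - 1) * E * (r ^ n) ^ 2) := by
      rw [Real.sqrt_mul (by positivity), Real.sqrt_sq (by positivity)]
    rw [hr2]
    refine Real.sqrt_le_sqrt ?_
    have hEn : ∫ p in Icc (left n) (right n) ×ˢ Icc (left n) (right n),
        gagliardoIntegrand α u p ≤ E :=
      setIntegral_mono_set hint
        (Filter.Eventually.of_forall fun p => gagliardoIntegrand_nonneg α u p)
        (Filter.Eventually.of_forall hsub2)
    have hcoef : (right n - left n) ^ α / (right (n + 1) - left (n + 1)) =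
        2 * (b - a) ^ (α - 1) * (r ^ n) ^ 2 := by
      have h1 : (r ^ n) ^ 2 = ((1 / 2 : ℝ) ^ n) ^ (α - 1) := by
        rw [hr, ← Real.rpow_natCast, ← Real.rpow_natCast, ← Real.rpow_natCast,
          ← Real.rpow_mul (by positivity), ← Real.rpow_mul (by positivity),
          ← Real.rpow_mul (by positivity)]
        congr 1; push_cast; ring
      rw [h1, mul_assoc, ← Real.mul_rpow (by positivity) (by positivity), hlen, hlen,
        Real.rpow_sub_one (by positivity), pow_succ, mul_comm (b - a)]
      field_simp
    rw [hcoef]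
    calc 2 * (b - a) ^ (α - 1) * (r ^ n) ^ 2 * _ ≤ 2 * (b - a) ^ (α - 1) * (r ^ n) ^ 2 * E := by
          gcongr
      _ = _ := by ring
  have htel (n : ℕ) : rootMeanSquare u a b ≤
      rootMeanSquare u (left n) (right n) + D * ∑ k ∈ Finset.range n, r ^ k := by
    induction n with
    | zero => simp [left, right]
    | succ n ih =>
      rw [Finset.sum_range_succ, mul_add]
      linarith [hstep n]
  have hgeom (n : ℕ) : ∑ k ∈ Finset.range n, r ^ k ≤ 1 / (1 - r) := by
    rw [one_div, ← tsum_geometric_of_lt_one hr0.le hr1]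
    exact (summable_geometric_of_lt_one hr0.le hr1).sum_le_tsum _ fun k _ => by positivity
  have hbound : rootMeanSquare u a b ≤ D * (1 / (1 - r)) := by
    refine le_of_forall_pos_le_add fun ε hε => ?_
    obtain ⟨δ, hδ, hclose⟩ := Metric.continuousOn_iff.1 hu z hz ε hε
    obtain ⟨n, hn⟩ := exists_pow_lt_of_lt_one (div_pos hδ hba0) (by norm_num : (1 / 2 : ℝ) < 1)
    rw [lt_div_iff₀ hba0] at hn
    have hsmall : rootMeanSquare u (left n) (right n) ≤ ε := by
      refine rootMeanSquare_le_of_abs_le (hlt n) (hu.mono (hsub n)) hε.le fun x hx => ?_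
      have hzn : z ∈ Icc (left n) (right n) := by
        have h1 : (0 : ℝ) ≤ (1 / 2) ^ n * (z - a) := mul_nonneg (by positivity) (by linarith [hz.1])
        have h2 : (0 : ℝ) ≤ (1 / 2) ^ n * (b - z) := mul_nonneg (by positivity) (by linarith [hz.2])
        constructor <;> simp only [left, right] <;> linarith
      have hxz : dist x z < δ := by
        have := Real.dist_le_of_mem_Icc hx hzn
        linarith [hlen n]
      have := hclose x (hsub n hx) hxz
      rw [huz, Real.dist_eq, sub_zero] at this
      exact this.le
    have := mul_le_mul_of_nonneg_left (hgeom n) (Real.sqrt_nonneg (2 * (b - a) ^ (α - 1) * E))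
    linarith [htel n]
  have hsq : (∫ x in Icc a b, u x ^ 2) / (b - a) ≤ (D * (1 / (1 - r))) ^ 2 := by
    rw [← sq_rootMeanSquare u hab]
    exact pow_le_pow_left₀ (Real.sqrt_nonneg _) hbound 2
  rw [div_le_iff₀ hba0, mul_pow, hD, Real.sq_sqrt (by positivity),
    Real.rpow_sub_one hba0.ne'] at hsq
  refine hsq.trans_eq ?_
  rw [poincareConst, ← hr]
  field_simp

theorem bddAbove_range_iInf_abs_sub {X : Finset ℝ} (hX : X.Nonempty) :
    BddAbove (range fun x : Icc (0 : ℝ) 1 => ⨅ j : X, |(x : ℝ) - (j : ℝ)|) := by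
  obtain ⟨y, hy⟩ := hX
  refine ⟨1 + |y|, ?_⟩
  rintro _ ⟨x, rfl⟩
  refine (ciInf_le (Finite.bddBelow_range _) (⟨y, hy⟩ : X)).trans ?_
  refine (abs_sub _ _).trans ?_
  gcongr
  exact abs_le.2 ⟨by linarith [x.2.1], x.2.2⟩

theorem exists_mem_abs_sub_le_fillDist {X : Finset ℝ} (hX : X.Nonempty) {x : ℝ}
    (hx : x ∈ Icc (0 : ℝ) 1) : ∃ y ∈ X, |x - y| ≤ fillDist X := by
  have : Nonempty X := hX.to_subtype
  obtain ⟨y, hy⟩ := exists_eq_ciInf_of_finite (f := fun j : X => |x - (j : ℝ)|)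
  refine ⟨y, y.2, ?_⟩
  rw [hy]
  exact le_ciSup (bddAbove_range_iInf_abs_sub hX) (⟨x, hx⟩ : Icc (0 : ℝ) 1)

theorem fillDist_pos {X : Finset ℝ} (hX : X.Nonempty) (hsub : ↑X ⊆ Ioo (0 : ℝ) 1) :
    0 < fillDist X := by
  obtain ⟨y, hy, hle⟩ := exists_mem_abs_sub_le_fillDist hX (left_mem_Icc.2 zero_le_one)
  refine lt_of_lt_of_le ?_ hle
  simpa using (hsub hy).1.ne'

/-- The Poincaré inequality summed over a uniform partition of `[0, 1]` each cell of which
contains a zero. -/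
theorem setIntegral_sq_le_of_zeros_in_cells {α : ℝ} (hα : 1 < α) {u : ℝ → ℝ}
    (hu : ContinuousOn u (Icc 0 1))
    (hint : IntegrableOn (gagliardoIntegrand α u) (Icc 0 1 ×ˢ Icc 0 1)) {M : ℕ} (hM : 0 < M)
    (hzero : ∀ k < M, ∃ z ∈ Icc ((k : ℝ) / M) ((k + 1 : ℕ) / M), u z = 0) :
    ∫ x in Icc (0 : ℝ) 1, u x ^ 2 ≤ poincareConst α * (1 / M : ℝ) ^ α *
      ∫ p in Icc (0 : ℝ) 1 ×ˢ Icc (0 : ℝ) 1, gagliardoIntegrand α u p := by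
  have hM0 : (0 : ℝ) < M := by exact_mod_cast hM
  let g : ℕ → ℝ := fun k => (k : ℝ) / M
  have hmono : Monotone g := fun i j hij => by simp only [g]; gcongr
  have hg0 : g 0 = 0 := by simp [g]
  have hgM : g M = 1 := by simp [g, hM0.ne']
  have hcell (k : ℕ) : g (k + 1) - g k = 1 / M := by simp only [g]; push_cast; ring
  have hlt (k : ℕ) : g k < g (k + 1) := by
    have : (0 : ℝ) < 1 / M := by positivity
    linarith [hcell k]
  have hsub {k : ℕ} (hk : k < M) : Icc (g k) (g (k + 1)) ⊆ Icc 0 1 := by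
    rw [← hg0, ← hgM]
    exact Icc_subset_Icc (hmono (Nat.zero_le k)) (hmono hk)
  have hIoc (k : ℕ) : Ioc (g k) (g (k + 1)) ×ˢ Ioc (g k) (g (k + 1)) =ᵐ[volume]
      Icc (g k) (g (k + 1)) ×ˢ Icc (g k) (g (k + 1)) := by
    rw [Measure.volume_eq_prod]
    exact Measure.set_prod_ae_eq Ioc_ae_eq_Icc Ioc_ae_eq_Icc
  have hleft : ∫ x in Icc (0 : ℝ) 1, u x ^ 2 =
      ∑ k ∈ Finset.range M, ∫ x in Icc (g k) (g (k + 1)), u x ^ 2 := by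
    have h := sum_integral_adjacent_intervals (f := fun x => u x ^ 2) (μ := volume) (a := g)
      (n := M) fun k hk => by
        refine ContinuousOn.intervalIntegrable ?_
        rw [uIcc_of_le (hlt k).le]
        exact (hu.mono (hsub hk)).pow 2
    rw [hg0, hgM, integral_of_le zero_le_one, ← integral_Icc_eq_integral_Ioc] at h
    rw [← h]
    refine Finset.sum_congr rfl fun k _ => ?_
    rw [integral_of_le (hlt k).le, integral_Icc_eq_integral_Ioc]
  have hright : ∑ k ∈ Finset.range M, ∫ p in Icc (g k) (g (k + 1)) ×ˢ Icc (g k) (g (k + 1)),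
      gagliardoIntegrand α u p ≤ ∫ p in Icc (0 : ℝ) 1 ×ˢ Icc (0 : ℝ) 1,
        gagliardoIntegrand α u p := by
    have hsq {k : ℕ} (hk : k < M) : Ioc (g k) (g (k + 1)) ×ˢ Ioc (g k) (g (k + 1)) ⊆
        Icc (0 : ℝ) 1 ×ˢ Icc (0 : ℝ) 1 :=
      prod_mono (Ioc_subset_Icc_self.trans (hsub hk)) (Ioc_subset_Icc_self.trans (hsub hk))
    calc _ = ∑ k ∈ Finset.range M, ∫ p in Ioc (g k) (g (k + 1)) ×ˢ Ioc (g k) (g (k + 1)),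
          gagliardoIntegrand α u p :=
          Finset.sum_congr rfl fun k _ => (setIntegral_congr_set (hIoc k)).symm
      _ = ∫ p in ⋃ k ∈ Finset.range M, Ioc (g k) (g (k + 1)) ×ˢ Ioc (g k) (g (k + 1)),
          gagliardoIntegrand α u p := by
          refine (integral_biUnion_finset _
            (fun k _ => measurableSet_Ioc.prod measurableSet_Ioc) ?_
            fun k hk => hint.mono_set (hsq (Finset.mem_range.1 hk))).symm
          intro i _ j _ hij
          exact disjoint_prod.2 (Or.inl (hmono.pairwise_disjoint_on_Ioc_succ hij))
      _ ≤ _ := by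
          refine setIntegral_mono_set hint
            (Filter.Eventually.of_forall fun p => gagliardoIntegrand_nonneg α u p)
            (Filter.Eventually.of_forall ?_)
          exact iUnion₂_subset fun k hk => hsq (Finset.mem_range.1 hk)
  rw [hleft]
  calc _ ≤ ∑ k ∈ Finset.range M, poincareConst α * (1 / M : ℝ) ^ α *
        ∫ p in Icc (g k) (g (k + 1)) ×ˢ Icc (g k) (g (k + 1)), gagliardoIntegrand α u p := by
        refine Finset.sum_le_sum fun k hk => ?_
        have hk' := hsub (Finset.mem_range.1 hk)
        obtain ⟨z, hz, huz⟩ := hzero k (Finset.mem_range.1 hk)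
        rw [← hcell k]
        exact setIntegral_sq_le_of_zero hα (hlt k) hz huz (hu.mono hk')
          (hint.mono_set (prod_mono hk' hk'))
    _ ≤ _ := by
        rw [← Finset.mul_sum]
        have := poincareConst_pos hα
        gcongr

theorem stmt_12 (α : ℝ) (hα₁ : 1 < α) (hα₂ : α < 2) :
    ∃ C > (0:ℝ), ∃ h₀ > (0:ℝ),
      ∀ X : Finset ℝ, X.Nonempty → ↑X ⊆ Set.Ioo (0:ℝ) 1 →
        fillDist X ≤ h₀ →
        ∀ u : ℝ → ℝ, ContinuousOn u (Set.Icc 0 1) →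
          -- finite Gagliardo seminorm `|u|_{H^{α/2}(0,1)} < ∞`:
          IntegrableOn
            (fun p : ℝ × ℝ => (u p.1 - u p.2) ^ 2 / |p.1 - p.2| ^ (1 + α))
            (Set.Ioo (0:ℝ) 1 ×ˢ Set.Ioo (0:ℝ) 1) →
          -- `u` vanishes on the sampling set:
          (∀ i ∈ X, u i = 0) →
          Real.sqrt (∫ x in Set.Ioo (0:ℝ) 1, u x ^ 2)
            ≤ C * fillDist X ^ (α / 2) *
              Real.sqrt (∫ p in Set.Ioo (0:ℝ) 1 ×ˢ Set.Ioo (0:ℝ) 1,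
                (u p.1 - u p.2) ^ 2 / |p.1 - p.2| ^ (1 + α)) := by
  have hP := poincareConst_pos hα₁
  refine ⟨Real.sqrt (poincareConst α * 4 ^ α), by positivity, 1 / 2, by norm_num, ?_⟩
  intro X hX hsub hh u hu hint hzero
  have hpos := fillDist_pos hX hsub
  set h := fillDist X
  change IntegrableOn (gagliardoIntegrand α u) _ at hint
  change _ ≤ _ * Real.sqrt (∫ p in Ioo (0 : ℝ) 1 ×ˢ Ioo (0 : ℝ) 1, gagliardoIntegrand α u p)
  have hae : Ioo (0 : ℝ) 1 ×ˢ Ioo (0 : ℝ) 1 =ᵐ[volume] Icc (0 : ℝ) 1 ×ˢ Icc (0 : ℝ) 1 := by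
    rw [Measure.volume_eq_prod]
    exact Measure.set_prod_ae_eq Ioo_ae_eq_Icc Ioo_ae_eq_Icc
  rw [setIntegral_congr_set hae, ← integral_Icc_eq_integral_Ioo]
  have hint' := hint.congr_set_ae hae.symm
  set E := ∫ p in Icc (0 : ℝ) 1 ×ˢ Icc (0 : ℝ) 1, gagliardoIntegrand α u p
  have hE0 : 0 ≤ E := integral_nonneg fun p => gagliardoIntegrand_nonneg α u p
  set M := ⌊1 / (2 * h)⌋₊
  have hM : 0 < M := Nat.floor_pos.2 ((one_le_div (by positivity)).2 (by linarith))
  have hM1 : (1 : ℝ) ≤ M := by exact_mod_cast hM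
  have hM0 : (0 : ℝ) < M := by linarith
  have hMle : (M : ℝ) * (2 * h) ≤ 1 :=
    (le_div_iff₀ (by positivity)).1 (Nat.floor_le (by positivity))
  have hMlt : 1 < ((M : ℝ) + 1) * (2 * h) :=
    (div_lt_iff₀ (by positivity)).1 (Nat.lt_floor_add_one _)
  have hcell : 1 / (M : ℝ) ≤ 4 * h := by
    rw [div_le_iff₀ hM0]; nlinarith
  have hhalf : h ≤ 1 / (2 * M) := by
    rw [le_div_iff₀ (by positivity)]; linarith
  have hbound := setIntegral_sq_le_of_zeros_in_cells hα₁ hu hint' hM fun k hk => by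
    have hk1 : (k : ℝ) + 1 ≤ M := by exact_mod_cast hk
    have hmid : (k : ℝ) / M + 1 / (2 * M) ∈ Icc (0 : ℝ) 1 := by
      refine ⟨by positivity, ?_⟩
      have : (k : ℝ) / M + 1 / (2 * M) = (k + 1 / 2) / M := by field_simp
      rw [this, div_le_one hM0]
      linarith
    obtain ⟨z, hzX, hz⟩ := exists_mem_abs_sub_le_fillDist hX hmid
    refine ⟨z, ?_, hzero z hzX⟩
    have hz' := abs_le.1 (hz.trans hhalf)
    have hsplit : ((k + 1 : ℕ) : ℝ) / M = k / M + 1 / (2 * M) + 1 / (2 * M) := by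
      push_cast; field_simp; ring
    rw [hsplit]
    constructor <;> linarith [hz'.1, hz'.2]
  calc Real.sqrt (∫ x in Icc (0 : ℝ) 1, u x ^ 2)
      ≤ Real.sqrt (poincareConst α * 4 ^ α * (h ^ (α / 2)) ^ 2 * E) := by
        refine Real.sqrt_le_sqrt (hbound.trans ?_)
        have hpow : (4 : ℝ) ^ α * (h ^ (α / 2)) ^ 2 = (4 * h) ^ α := by
          rw [Real.mul_rpow (by norm_num) hpos.le, ← Real.rpow_natCast, ← Real.rpow_mul hpos.le]
          congr 2; push_cast; ring
        rw [mul_assoc (poincareConst α) (4 ^ α), hpow]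
        gcongr
    _ = _ := by
        rw [Real.sqrt_mul (by positivity), Real.sqrt_mul (by positivity),
          Real.sqrt_sq (by positivity)]
end
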